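/- arXiv:2208.02637 — 4 statements merged into one kernel-verified Lean document; each statement's English description precedes it below -/
import Mathlib

section
/- Let A = {a_n : n ∈ ℕ} be a real sequence of class (A), i.e. a_0 = 0, a_{n+1} − a_n ≥ 1 for every n ∈ ℕ, and log a_n = o(n) as n → ∞. Then for every p with 0 ≤ p < 1 there exists a Lebesgue measurable set E ⊆ ℝ such that |E ∩ [m, m+1]| ≥ p for every integer m ∈ ℤ, but E contains no affine copy of A; that is, for every x ∈ ℝ and every t > 0 the set {x + t·a_n : n ∈ ℕ} is not contained in E. -/
open MeasureTheory Filter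

/-- Union bound: a random choice function hits all patterns. -/
lemma exists_hitting_choice {P : Type} [Fintype P] (M K : ℕ) (hKpos : 0 < K)
    (blk : P → Fin M → ℤ) (hinj : ∀ p, Function.Injective (blk p))
    (cell : P → Fin M → Fin K)
    (hcard : Fintype.card P * (K - 1) ^ M < K ^ M) :
    ∃ c : ℤ → Fin K, ∀ p, ∃ n, c (blk p n) = cell p n := by
  classical
  let B : Finset ℤ := Finset.univ.biUnion fun p => Finset.univ.image (blk p)
  have hB : ∀ p n, blk p n ∈ B := fun p n =>
    Finset.mem_biUnion.2 ⟨p, Finset.mem_univ _, Finset.mem_image.2 ⟨n, Finset.mem_univ _, rfl⟩⟩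
  let S : P → B → Finset (Fin K) := fun p b =>
    Finset.univ.filter fun j => ∀ n, blk p n = b.1 → j ≠ cell p n
  let bad : P → Finset (B → Fin K) := fun p => Fintype.piFinset (S p)
  have hbad : ∀ p, (bad p).card * K ^ M ≤ (K - 1) ^ M * K ^ B.card := by
    intro p
    let I : Finset B := Finset.univ.image fun n => (⟨blk p n, hB p n⟩ : B)
    have hI : I.card = M := by
      rw [Finset.card_image_of_injective]
      · simp
      · intro m n h
        exact hinj p (by simpa using h)
    have h1 : (bad p).card = (∏ b ∈ I, (S p b).card) * ∏ b ∈ Iᶜ, (S p b).card := by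
      rw [Finset.prod_mul_prod_compl]
      exact Fintype.card_piFinset _
    have h2 : ∏ b ∈ I, (S p b).card ≤ (K - 1) ^ M := by
      rw [← hI]
      apply Finset.prod_le_pow_card
      intro b hb
      obtain ⟨n, -, rfl⟩ := Finset.mem_image.1 hb
      have : S p ⟨blk p n, hB p n⟩ ⊆ Finset.univ.erase (cell p n) := by
        intro j hj
        have := (Finset.mem_filter.1 hj).2 n rfl
        simpa using this
      calc _ ≤ _ := Finset.card_le_card this
        _ = K - 1 := by simp
    have h3 : ∏ b ∈ Iᶜ, (S p b).card ≤ K ^ (Iᶜ).card := by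
      apply Finset.prod_le_pow_card
      intro b _
      simpa using Finset.card_le_univ (S p b)
    have h4 : (Iᶜ).card + M = B.card := by
      have := Finset.card_compl_add_card I
      rw [hI] at this
      simpa using this
    calc (bad p).card * K ^ M ≤ ((K - 1) ^ M * K ^ (Iᶜ).card) * K ^ M := by
          rw [h1]; gcongr
      _ = _ := by rw [← h4, pow_add]; ring
  have hlt : (Finset.univ.biUnion bad).card < (Finset.univ : Finset (B → Fin K)).card := by
    have h5 : (Finset.univ.biUnion bad).card * K ^ M < K ^ B.card * K ^ M := by
      calc (Finset.univ.biUnion bad).card * K ^ M ≤ (∑ p, (bad p).card) * K ^ M := by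
            gcongr; exact Finset.card_biUnion_le
        _ = ∑ p, (bad p).card * K ^ M := Finset.sum_mul ..
        _ ≤ ∑ _p : P, (K - 1) ^ M * K ^ B.card := Finset.sum_le_sum fun p _ => hbad p
        _ = (Fintype.card P * (K - 1) ^ M) * K ^ B.card := by simp [mul_assoc]
        _ < K ^ M * K ^ B.card := by
            gcongr
        _ = _ := mul_comm _ _
    have := lt_of_mul_lt_mul_right h5 (Nat.zero_le _)
    simpa using this
  obtain ⟨c, -, hc⟩ := Finset.exists_mem_notMem_of_card_lt_card hlt
  refine ⟨fun z => if h : z ∈ B then c ⟨z, h⟩ else ⟨0, hKpos⟩, fun p => ?_⟩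
  by_contra! hne
  apply hc
  refine Finset.mem_biUnion.2 ⟨p, Finset.mem_univ _, Fintype.mem_piFinset.2 fun b => ?_⟩
  refine Finset.mem_filter.2 ⟨Finset.mem_univ _, fun n hn => ?_⟩
  have := hne n
  rw [dif_pos (hB p n)] at this
  have hb : b = ⟨blk p n, hB p n⟩ := Subtype.ext hn.symm
  rw [hb]; exact this

lemma growth_lemma (a : ℕ → ℝ) (hpos : ∀ n, 1 ≤ n → 0 < a n)
    (hgrowth : Tendsto (fun n : ℕ => Real.log (a n) / (n : ℝ)) atTop (nhds 0))
    (C r : ℝ) (hC : 0 < C) (hr0 : 0 < r) (hr1 : r < 1) :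
    ∃ M : ℕ, 1 ≤ M ∧ C * a M * r ^ M < 1 := by
  have hρ : 0 < -Real.log r / 2 := by have := Real.log_neg hr0 hr1; linarith
  have h1 := hgrowth.eventually (gt_mem_nhds hρ)
  have h2 : ∀ᶠ n : ℕ in atTop, Real.log C / (-Real.log r / 2) < (n : ℝ) :=
    tendsto_natCast_atTop_atTop.eventually_gt_atTop _
  obtain ⟨M, h1, h2, hM⟩ := (h1.and (h2.and (eventually_ge_atTop 1))).exists
  refine ⟨M, hM, ?_⟩
  have hMp : (0:ℝ) < M := by exact_mod_cast hM
  rw [div_lt_iff₀ hMp] at h1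
  rw [div_lt_iff₀ hρ] at h2
  have ha := hpos M hM
  have : 0 < C * a M * r ^ M := by positivity
  rw [← Real.log_neg_iff this, Real.log_mul (by positivity) (by positivity),
    Real.log_mul (by positivity) (by positivity), Real.log_pow]
  nlinarith

lemma discrete_choice
    (a : ℕ → ℝ) (h0 : a 0 = 0) (hgap : ∀ n : ℕ, 1 ≤ a (n + 1) - a n)
    (hgrowth : Tendsto (fun n : ℕ => Real.log (a n) / (n : ℝ)) atTop (nhds 0))
    (K R : ℕ) (hK : 2 ≤ K) (hR : 1 ≤ R) :
    ∃ c : ℤ → Fin K, ∀ α τ : ℝ, |α| ≤ R → 1 ≤ τ → τ ≤ R →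
      ∃ (n : ℕ) (b : ℤ), |α + τ * a n - b - ((c b : ℕ) : ℝ) / K| ≤ 2 / K := by
  have hmono : StrictMono a := strictMono_nat_of_lt_succ fun n => by linarith [hgap n]
  have hge : ∀ n, 1 ≤ n → 1 ≤ a n := by
    intro n hn
    have := hmono.monotone hn
    have := hgap 0
    simp only [zero_add] at this
    linarith
  have hKr : (2:ℝ) ≤ K := by exact_mod_cast hK
  have hRr : (1:ℝ) ≤ R := by exact_mod_cast hR
  have hK0 : (0:ℝ) < K := by linarith
  obtain ⟨M, hM, hlt⟩ := growth_lemma a (fun n hn => by linarith [hge n hn]) hgrowth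
    (30 * K ^ 2 * R ^ 2) (1 - 1 / K) (by positivity)
    (by rw [sub_pos, div_lt_one hK0]; linarith) (by have : (0:ℝ) < 1 / K := by positivity
                                                    linarith)
  set A : ℕ := ⌈a M⌉₊ with hA
  have haM := hge M hM
  have hA1 : a M ≤ A := Nat.le_ceil _
  have hA2 : (A:ℝ) ≤ 2 * a M := by
    have := Nat.ceil_lt_add_one (a := a M) (by linarith)
    rw [← hA] at this
    linarith
  have hA3 : (1:ℝ) ≤ A := haM.trans hA1
  let P := Fin (4 * K * R + 1) × Fin (2 * K * A * R + 1)
  let y : P → ℕ → ℝ := fun p n =>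
    ((p.1 : ℕ) : ℝ) / (2 * K) - R + (1 + ((p.2 : ℕ) : ℝ) / (2 * K * A)) * a n
  have hy : ∀ p n, y p n + 1 ≤ y p (n + 1) := by
    intro p n
    have : (0:ℝ) ≤ ((p.2 : ℕ) : ℝ) / (2 * K * A) := by positivity
    have := hgap n
    simp only [y]
    nlinarith
  have hblk : ∀ p, StrictMono fun n => ⌊y p n⌋ := by
    intro p
    refine strictMono_nat_of_lt_succ fun n => ?_
    have h := Int.floor_le_floor (hy p n)
    rw [Int.floor_add_one] at h
    omega
  have hcell : ∀ u : ℝ, ⌊K * Int.fract u⌋₊ < K := by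
    intro u
    rw [Nat.floor_lt (by have := Int.fract_nonneg u; positivity)]
    have := Int.fract_lt_one u
    nlinarith
  obtain ⟨c, hc⟩ := exists_hitting_choice (P := P) M K (by omega) (fun p n => ⌊y p n⌋)
    (fun p m n h => Fin.ext ((hblk p).injective h))
    (fun p n => ⟨⌊K * Int.fract (y p n)⌋₊, hcell _⟩) (by
      have h1 : ((Fintype.card P : ℕ) : ℝ) ≤ 30 * K ^ 2 * R ^ 2 * a M := by
        simp only [P, Fintype.card_prod, Fintype.card_fin]
        push_cast
        have hKR : (1:ℝ) ≤ K * R := by nlinarith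
        have hKRA : (1:ℝ) ≤ K * R * A := by nlinarith
        calc (4 * (K:ℝ) * R + 1) * (2 * K * A * R + 1)
            ≤ (5 * (K * R)) * (3 * (K * R * A)) := by
              apply mul_le_mul <;> first | positivity | nlinarith
          _ = 15 * K ^ 2 * R ^ 2 * A := by ring
          _ ≤ 15 * K ^ 2 * R ^ 2 * (2 * a M) := by gcongr
          _ = _ := by ring
      have h2 : (1 - 1 / (K:ℝ)) = ((K - 1 : ℕ) : ℝ) / K := by
        rw [Nat.cast_sub (by omega)]; field_simp; simp
      rw [h2, div_pow, mul_div_assoc', div_lt_one (by positivity)] at hlt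
      have h3 : ((Fintype.card P : ℕ) : ℝ) * ((K - 1 : ℕ) : ℝ) ^ M < (K:ℝ) ^ M :=
        lt_of_le_of_lt (by gcongr) hlt
      exact_mod_cast h3)
  refine ⟨c, fun α τ hα hτ1 hτ2 => ?_⟩
  obtain ⟨hα1, hα2⟩ := abs_le.1 hα
  set i := ⌊(α + R) * (2 * K)⌋₊ with hi
  set j := ⌊(τ - 1) * (2 * K * A)⌋₊ with hj
  have hi0 : 0 ≤ (α + R) * (2 * K) := mul_nonneg (by linarith) (by positivity)
  have hj0 : 0 ≤ (τ - 1) * (2 * K * A) := mul_nonneg (by linarith) (by positivity)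
  have hi1 := Nat.floor_le hi0
  have hi2 := Nat.lt_floor_add_one ((α + R) * (2 * K))
  have hj1 := Nat.floor_le hj0
  have hj2 := Nat.lt_floor_add_one ((τ - 1) * (2 * K * A))
  rw [← hi] at hi1 hi2
  rw [← hj] at hj1 hj2
  have hi3 : i < 4 * K * R + 1 := by
    have : (i:ℝ) ≤ 4 * K * R := by nlinarith
    have : i ≤ 4 * K * R := by exact_mod_cast this
    omega
  have hj3 : j < 2 * K * A * R + 1 := by
    have h : (τ - 1) * (2 * K * A) ≤ R * (2 * K * A) := by gcongr; linarith
    have : (j:ℝ) ≤ 2 * K * A * R := by linarith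
    have : j ≤ 2 * K * A * R := by exact_mod_cast this
    omega
  obtain ⟨n, hn⟩ := hc (⟨i, hi3⟩, ⟨j, hj3⟩)
  set u := y (⟨i, hi3⟩, ⟨j, hj3⟩) n with hu
  refine ⟨n, ⌊u⌋, ?_⟩
  rw [hn]
  simp only
  have hf0 : 0 ≤ K * Int.fract u := by have := Int.fract_nonneg u; positivity
  have hf1 := Nat.floor_le hf0
  have hf2 := Nat.lt_floor_add_one (K * Int.fract u)
  set q := ⌊K * Int.fract u⌋₊
  have han : a n ≤ A := (hmono.monotone n.2.le).trans hA1
  have han0 : 0 ≤ a n := by rw [← h0]; exact hmono.monotone (Nat.zero_le _)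
  -- errors
  have e1 : 0 ≤ α - ((i:ℝ) / (2 * K) - R) ∧ α - ((i:ℝ) / (2 * K) - R) ≤ 1 / (2 * K) := by
    have h1 : (i:ℝ) / (2 * K) ≤ α + R := by rw [div_le_iff₀ (by positivity)]; exact hi1
    have h2 : α + R ≤ (i + 1 : ℝ) / (2 * K) := by rw [le_div_iff₀ (by positivity)]; exact hi2.le
    rw [add_div] at h2
    constructor <;> linarith
  have e2 : 0 ≤ τ - (1 + (j:ℝ) / (2 * K * A)) ∧
      τ - (1 + (j:ℝ) / (2 * K * A)) ≤ 1 / (2 * K * A) := by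
    have h1 : (j:ℝ) / (2 * K * A) ≤ τ - 1 := by rw [div_le_iff₀ (by positivity)]; exact hj1
    have h2 : τ - 1 ≤ (j + 1 : ℝ) / (2 * K * A) := by
      rw [le_div_iff₀ (by positivity)]; exact hj2.le
    rw [add_div] at h2
    constructor <;> linarith
  have e3 : 0 ≤ (τ - (1 + (j:ℝ) / (2 * K * A))) * a n ∧
      (τ - (1 + (j:ℝ) / (2 * K * A))) * a n ≤ 1 / (2 * K) := by
    refine ⟨mul_nonneg e2.1 han0, ?_⟩
    calc _ ≤ 1 / (2 * K * A) * (A:ℝ) := by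
            apply mul_le_mul e2.2 han han0; positivity
      _ = 1 / (2 * K) := by field_simp
  have e4 : 0 ≤ Int.fract u - (q:ℝ) / K ∧ Int.fract u - (q:ℝ) / K ≤ 1 / K := by
    have h1 : (q:ℝ) / K ≤ Int.fract u := by rw [div_le_iff₀ hK0]; linarith
    have h2 : Int.fract u ≤ (q + 1 : ℝ) / K := by rw [le_div_iff₀ hK0]; linarith
    rw [add_div] at h2
    constructor <;> linarith
  have hfl : (⌊u⌋ : ℝ) + Int.fract u = u := Int.floor_add_fract u
  have huv : u = (i:ℝ) / (2 * K) - R + (1 + (j:ℝ) / (2 * K * A)) * a n := rfl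
  have key : α + τ * a n - ⌊u⌋ - (q:ℝ) / K = (α - ((i:ℝ) / (2 * K) - R)) +
      (τ - (1 + (j:ℝ) / (2 * K * A))) * a n + (Int.fract u - (q:ℝ) / K) := by
    have : (⌊u⌋ : ℝ) = (i:ℝ) / (2 * K) - R + (1 + (j:ℝ) / (2 * K * A)) * a n - Int.fract u := by
      linarith
    rw [this]; ring
  have hhalf : 1 / (2 * K) + 1 / (2 * K) = 1 / (K:ℝ) := by field_simp; norm_num
  have htwo : 2 / (K:ℝ) = 1 / K + 1 / K := by ring
  rw [key, abs_le, htwo]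
  have : 0 < 1 / (K:ℝ) := by positivity
  constructor <;> linarith [e1.1, e1.2, e3.1, e3.2, e4.1, e4.2]

/-- The set hit by all affine copies in a given parameter range. -/
lemma small_hitting_set
    (a : ℕ → ℝ) (h0 : a 0 = 0) (hgap : ∀ n : ℕ, 1 ≤ a (n + 1) - a n)
    (hgrowth : Tendsto (fun n : ℕ => Real.log (a n) / (n : ℝ)) atTop (nhds 0))
    (L : ℕ) (hL : 1 ≤ L) (ε : ℝ) (hε : 0 < ε) :
    ∃ F : Set ℝ, MeasurableSet F ∧
      (∀ m : ℤ, volume (F ∩ Set.Icc (m : ℝ) ((m : ℝ) + 1)) ≤ ENNReal.ofReal ε) ∧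
      (∀ x t : ℝ, |x| ≤ L → 1 / L ≤ t → t ≤ L → ∃ n, x + t * a n ∈ F) := by
  obtain ⟨K, hK⟩ := exists_nat_gt (max 2 (32 / ε))
  have hK2r : (2:ℝ) < K := (le_max_left _ _).trans_lt hK
  have hKε : 32 / ε < K := (le_max_right _ _).trans_lt hK
  have hK2 : 2 ≤ K := by exact_mod_cast hK2r.le
  have hK0 : (0:ℝ) < K := by linarith
  have hLr : (1:ℝ) ≤ L := by exact_mod_cast hL
  have hL0 : (0:ℝ) < L := by linarith
  obtain ⟨c, hc⟩ := discrete_choice a h0 hgap hgrowth K (L * L) hK2 (by nlinarith)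
  let J : ℤ → Set ℝ := fun b =>
    Set.Icc ((b + ((c b : ℕ) : ℝ) / K - 2 / K) / L) ((b + ((c b : ℕ) : ℝ) / K + 2 / K) / L)
  refine ⟨⋃ b, J b, MeasurableSet.iUnion fun b => measurableSet_Icc, ?_, ?_⟩
  · intro m
    have hsub : (⋃ b, J b) ∩ Set.Icc (m : ℝ) ((m : ℝ) + 1) ⊆
        ⋃ b ∈ Finset.Icc (L * m - 2) (L * m + L + 1), J b := by
      rintro z ⟨hz, hz1, hz2⟩
      obtain ⟨b, hb⟩ := Set.mem_iUnion.1 hz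
      refine Set.mem_biUnion ?_ hb
      obtain ⟨hb1, hb2⟩ := hb
      rw [div_le_iff₀ hL0] at hb1
      rw [le_div_iff₀ hL0] at hb2
      have hq0 : 0 ≤ ((c b : ℕ) : ℝ) / K := by positivity
      have hq1 : ((c b : ℕ) : ℝ) / K < 1 := by
        rw [div_lt_one hK0]; exact_mod_cast (c b).2
      have h2K : 2 / (K:ℝ) < 1 := by rw [div_lt_one hK0]; exact hK2r
      have hlo : (m:ℝ) * L ≤ z * L := by gcongr
      have hhi : z * L ≤ (m + 1) * L := by gcongr
      have h1 : ((L * m - 2 : ℤ) : ℝ) < b := by push_cast; linarith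
      have h2 : (b : ℝ) < ((L * m + L + 1 : ℤ) : ℝ) := by push_cast; linarith
      simp only [Finset.coe_Icc, Set.mem_Icc]
      exact ⟨by exact_mod_cast h1.le, by exact_mod_cast h2.le⟩
    have hvol : ∀ b, volume (J b) = ENNReal.ofReal (4 / (K * L)) := by
      intro b
      rw [Real.volume_Icc]
      congr 1
      field_simp
      ring
    calc volume ((⋃ b, J b) ∩ Set.Icc (m : ℝ) ((m : ℝ) + 1))
        ≤ volume (⋃ b ∈ Finset.Icc (L * m - 2) (L * m + L + 1), J b) := measure_mono hsub
      _ ≤ ∑ b ∈ Finset.Icc (L * m - 2) (L * m + L + 1), volume (J b) :=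
          measure_biUnion_finset_le _ _
      _ = ((L + 4 : ℕ) : ENNReal) * ENNReal.ofReal (4 / (K * L)) := by
          simp only [hvol, Finset.sum_const, nsmul_eq_mul, Int.card_Icc]
          congr 2
          omega
      _ = ENNReal.ofReal (((L + 4 : ℕ) : ℝ) * (4 / (K * L))) := by
          rw [ENNReal.ofReal_mul (by positivity), ENNReal.ofReal_natCast]
      _ ≤ ENNReal.ofReal ε := by
          apply ENNReal.ofReal_le_ofReal
          rw [div_lt_iff₀ hε] at hKε
          rw [mul_div_assoc', div_le_iff₀ (by positivity)]
          push_cast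
          nlinarith
  · intro x t hx ht1 ht2
    rw [div_le_iff₀ hL0] at ht1
    obtain ⟨n, b, h⟩ := hc (L * x) (L * t)
      (by rw [abs_mul, abs_of_pos hL0]; push_cast; gcongr) (by linarith)
      (by push_cast; gcongr)
    refine ⟨n, Set.mem_iUnion.2 ⟨b, ?_⟩⟩
    obtain ⟨h1, h2⟩ := abs_le.1 h
    constructor
    · rw [div_le_iff₀ hL0]; linarith
    · rw [le_div_iff₀ hL0]; linarith

/-- **Large sets containing no affine copy of a slowly growing sequence.**
If `a : ℕ → ℝ` belongs to class (A) (`a 0 = 0`, `a (n+1) - a n ≥ 1`, `log (a n) = o(n)`),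
then for every `0 ≤ p < 1` there is a measurable set `E ⊆ ℝ` with
`|E ∩ [m, m+1]| ≥ p` for all `m ∈ ℤ`, containing no affine copy `{x + t * a n : n ∈ ℕ}`
with `x ∈ ℝ`, `t > 0`. -/
theorem large_set_no_affine_copy
    (a : ℕ → ℝ) (h0 : a 0 = 0) (hgap : ∀ n : ℕ, 1 ≤ a (n + 1) - a n)
    (hgrowth : Tendsto (fun n : ℕ => Real.log (a n) / (n : ℝ)) atTop (nhds 0))
    (p : ℝ) (hp0 : 0 ≤ p) (hp1 : p < 1) :
    ∃ E : Set ℝ, MeasurableSet E ∧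
      (∀ m : ℤ, ENNReal.ofReal p ≤ volume (E ∩ Set.Icc (m : ℝ) ((m : ℝ) + 1))) ∧
      (∀ x t : ℝ, 0 < t → ¬ (Set.range (fun n : ℕ => x + t * a n) ⊆ E)) := by
  have hp : 0 < 1 - p := by linarith
  choose F hF1 hF2 hF3 using fun k : ℕ => small_hitting_set a h0 hgap hgrowth (k + 1)
    (by omega) ((1 - p) / 2 / 2 ^ k) (by positivity)
  have hFm : MeasurableSet (⋃ k, F k) := MeasurableSet.iUnion hF1
  refine ⟨(⋃ k, F k)ᶜ, hFm.compl, ?_, ?_⟩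
  · intro m
    have hle : volume ((⋃ k, F k) ∩ Set.Icc (m : ℝ) ((m : ℝ) + 1)) ≤ ENNReal.ofReal (1 - p) := by
      rw [Set.iUnion_inter]
      calc _ ≤ ∑' k, volume (F k ∩ Set.Icc (m : ℝ) ((m : ℝ) + 1)) := measure_iUnion_le _
        _ ≤ ∑' k : ℕ, ENNReal.ofReal ((1 - p) / 2 / 2 ^ k) :=
            ENNReal.tsum_le_tsum fun k => hF2 k m
        _ = ENNReal.ofReal (1 - p) := by
            rw [← ENNReal.ofReal_tsum_of_nonneg (fun k => by positivity)
              (summable_geometric_two' _), tsum_geometric_two']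
    have hsum := measure_inter_add_diff (μ := volume) (Set.Icc (m : ℝ) ((m : ℝ) + 1)) hFm
    rw [Set.inter_comm, Real.volume_Icc] at hsum
    have heq : (⋃ k, F k)ᶜ ∩ Set.Icc (m : ℝ) ((m : ℝ) + 1) =
        Set.Icc (m : ℝ) ((m : ℝ) + 1) \ (⋃ k, F k) := by
      rw [Set.inter_comm, Set.diff_eq]
    rw [heq]
    have h1 : ENNReal.ofReal (1 - p) + ENNReal.ofReal p = ENNReal.ofReal ((m:ℝ) + 1 - m) := by
      rw [← ENNReal.ofReal_add hp.le hp0]; congr 1; ring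
    rw [← h1] at hsum
    refine (ENNReal.add_le_add_iff_left (a := ENNReal.ofReal (1 - p)) ENNReal.ofReal_ne_top).1 ?_
    rw [← hsum]
    gcongr
  · intro x t ht hsub
    obtain ⟨k, hk⟩ := exists_nat_gt (max |x| (max t (1 / t)))
    have hx : |x| < k := (le_max_left _ _).trans_lt hk
    have ht1 : t < k := ((le_max_left _ _).trans (le_max_right _ _)).trans_lt hk
    have ht2 : 1 / t < k := ((le_max_right _ _).trans (le_max_right _ _)).trans_lt hk
    obtain ⟨n, hn⟩ := hF3 k x t (by push_cast; linarith) (by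
      push_cast
      rw [div_lt_iff₀ ht] at ht2
      rw [div_le_iff₀ (by positivity)]
      nlinarith) (by push_cast; linarith)
    exact hsub ⟨n, rfl⟩ (Set.mem_iUnion.2 ⟨k, hn⟩)
end

section
/- Let A = {a_n : n ∈ ℕ} be a real sequence of class (A), and let φ : ℕ × (0, +∞) → (0, +∞) be such that for each n the function t ↦ φ(n, t) is increasing, and there are constants C₁, C₂ > 0 such that for all n ∈ ℕ and all t > 0 one has C₁·t ≤ φ(n+1, t)·a_{n+1} − φ(n, t)·a_n and φ(n, t) ≤ C₂·t. Then for every p with 0 ≤ p < 1 there exists a Lebesgue measurable set E ⊆ ℝ that intersects every interval of unit length in a set of measure at least p, but E does not contain the set {x + φ(n, t)·a_n : n ∈ ℕ} for any choice of x ∈ ℝ and t > 0. -/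
open MeasureTheory Filter

lemma hit_aux {ι : Type*} (T : Finset ι) (N K : ℕ) (hK : 0 < K) (c : ι → ℕ → ℤ)
    (s : ι → ℕ → Fin K) (hc : ∀ i ∈ T, Function.Injective (c i))
    (h : (T.card : ℝ) * (1 - 1 / (K : ℝ)) ^ N < 1) :
    ∃ ω : ℤ → Fin K, ∀ i ∈ T, ∃ n < N, ω (c i n) = s i n := by
  classical
  by_contra hcon
  push Not at hcon
  set U : Finset ℤ := T.biUnion (fun i => (Finset.range N).image (c i)) with hU
  set bad : ι → Finset (U → Fin K) := fun i => Fintype.piFinset (fun u : U =>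
    if (u : ℤ) ∈ (Finset.range N).image (c i) then
      Finset.univ.erase (s i (Function.invFun (c i) u)) else Finset.univ) with hbad
  have hKr : (0 : ℝ) < K := by exact_mod_cast hK
  have hcover : (Finset.univ : Finset (U → Fin K)) ⊆ T.biUnion bad := by
    intro w _
    obtain ⟨i, hi, hw⟩ := hcon (fun z => if hz : z ∈ U then w ⟨z, hz⟩ else ⟨0, hK⟩)
    refine Finset.mem_biUnion.2 ⟨i, hi, ?_⟩
    rw [hbad, Fintype.mem_piFinset]
    rintro ⟨u, hu⟩
    split_ifs with hui
    · obtain ⟨n, hn, rfl⟩ := Finset.mem_image.1 hui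
      simp only [Finset.mem_erase, Finset.mem_univ, and_true]
      rw [Function.leftInverse_invFun (hc i hi) n]
      have := hw n (Finset.mem_range.1 hn)
      rwa [dif_pos hu] at this
    · simp
  have hcard : ∀ i ∈ T, ((bad i).card : ℝ) = (K : ℝ) ^ U.card * (1 - 1 / (K : ℝ)) ^ N := by
    intro i hi
    rw [hbad, Fintype.card_piFinset, Nat.cast_prod]
    have h1 : ∀ u : U, (((if (u : ℤ) ∈ (Finset.range N).image (c i) then
      Finset.univ.erase (s i (Function.invFun (c i) u)) else Finset.univ : Finset (Fin K)).card : ℕ) : ℝ)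
      = K * (if (u : ℤ) ∈ (Finset.range N).image (c i) then (1 - 1 / (K : ℝ)) else 1) := by
      intro u
      split_ifs
      · rw [Finset.card_erase_of_mem (Finset.mem_univ _), Finset.card_univ, Fintype.card_fin,
          Nat.cast_sub hK]
        field_simp
        simp
      · simp
    rw [Finset.prod_congr rfl (fun u _ => h1 u), Finset.prod_mul_distrib]
    congr 1
    · simp
    · rw [Finset.prod_coe_sort U (fun u => if u ∈ (Finset.range N).image (c i) then (1 - 1 / (K : ℝ)) else 1),
        Finset.prod_ite_mem, Finset.prod_const]
      congr 1
      rw [Finset.inter_eq_right.2, Finset.card_image_of_injective _ (hc i hi), Finset.card_range]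
      exact Finset.subset_biUnion_of_mem (fun i => (Finset.range N).image (c i)) hi
  have h2 : ((Finset.univ : Finset (U → Fin K)).card : ℝ) ≤ ∑ i ∈ T, ((bad i).card : ℝ) := by
    exact_mod_cast (Finset.card_le_card hcover).trans Finset.card_biUnion_le
  rw [Finset.sum_congr rfl hcard, Finset.sum_const, nsmul_eq_mul, Finset.card_univ] at h2
  simp only [Fintype.card_fun, Fintype.card_fin, Fintype.card_coe, Nat.cast_pow] at h2
  have h3 : (0 : ℝ) < (K : ℝ) ^ U.card := by positivity
  nlinarith

lemma growth_aux (a : ℕ → ℝ) (ha : ∀ n, 1 ≤ n → 0 < a n)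
    (hgrowth : Tendsto (fun n : ℕ => Real.log (a n) / (n : ℝ)) atTop (nhds 0))
    (r : ℝ) (hr0 : 0 < r) (hr1 : r < 1) (A B : ℝ) (hB : 0 ≤ B) (hA : 0 ≤ A) :
    ∃ N : ℕ, A * (N * (B * a N) + 1) * r ^ N < 1 := by
  set q := Real.sqrt r with hq
  have hq0 : 0 < q := Real.sqrt_pos.2 hr0
  have hqq : q * q = r := Real.mul_self_sqrt hr0.le
  have hq1 : q < 1 := by nlinarith
  have hlog : 0 < - Real.log q := by have := Real.log_neg hq0 hq1; linarith
  have e1 : ∀ᶠ n : ℕ in atTop, a n * r ^ n ≤ q ^ n := by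
    filter_upwards [hgrowth.eventually_lt_const hlog, eventually_ge_atTop 1] with n hn hn1
    have hnr : (0 : ℝ) < n := by exact_mod_cast hn1
    rw [div_lt_iff₀ hnr] at hn
    have : a n ≤ (q⁻¹) ^ n := by
      rw [← Real.log_le_log_iff (ha n hn1) (by positivity), Real.log_pow, Real.log_inv]
      linarith
    calc a n * r ^ n ≤ (q⁻¹) ^ n * r ^ n := by gcongr
      _ = q ^ n := by rw [← mul_pow, ← hqq]; congr 1; field_simp
  have t1 : Tendsto (fun n : ℕ => A * B * (n * q ^ n) + A * r ^ n) atTop (nhds 0) := by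
    have h1 := tendsto_self_mul_const_pow_of_lt_one hq0.le hq1
    have h2 := tendsto_pow_atTop_nhds_zero_of_lt_one hr0.le hr1
    simpa using (h1.const_mul (A * B)).add (h2.const_mul A)
  obtain ⟨N, h1, h2⟩ := (e1.and (t1.eventually_lt_const one_pos)).exists
  refine ⟨N, lt_of_le_of_lt ?_ h2⟩
  have : A * B * N * (a N * r ^ N) ≤ A * B * N * q ^ N := by gcongr
  nlinarith

lemma density_aux (K : ℕ) (hK : 0 < K) (δ : ℝ) (hδ : 0 < δ) (hδK : δ * K ≤ 1) (ω : ℤ → Fin K) (y : ℝ) :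
    volume ((⋃ c : ℤ, Set.Ico (((c * K + (ω c : ℕ) : ℤ) : ℝ) * δ) (((c * K + (ω c : ℕ) : ℤ) : ℝ) * δ + 2 * δ))
      ∩ Set.Icc y (y + 1)) ≤ ENNReal.ofReal (8 / K) := by
  have hKr : (1 : ℝ) ≤ K := by exact_mod_cast hK
  have hl : 0 < K * δ := by positivity
  set S : Finset ℤ := Finset.Icc (⌈y / (K * δ)⌉ - 2) ⌊(y + 1) / (K * δ)⌋ with hS
  have hsub : ((⋃ c : ℤ, Set.Ico (((c * K + (ω c : ℕ) : ℤ) : ℝ) * δ) (((c * K + (ω c : ℕ) : ℤ) : ℝ) * δ + 2 * δ))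
      ∩ Set.Icc y (y + 1)) ⊆ ⋃ c ∈ S, Set.Ico (((c * K + (ω c : ℕ) : ℤ) : ℝ) * δ) (((c * K + (ω c : ℕ) : ℤ) : ℝ) * δ + 2 * δ) := by
    rintro z ⟨hz, hz1, hz2⟩
    obtain ⟨c, hc⟩ := Set.mem_iUnion.1 hz
    refine Set.mem_iUnion₂.2 ⟨c, ?_, hc⟩
    have hw : (((ω c : ℕ) : ℝ)) + 1 ≤ K := by exact_mod_cast (ω c).2
    have hw0 : (0 : ℝ) ≤ ((ω c : ℕ) : ℝ) := by positivity
    obtain ⟨hc1, hc2⟩ := hc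
    push_cast at hc1 hc2
    rw [hS, Finset.mem_Icc, sub_le_iff_le_add, Int.ceil_le, Int.le_floor, div_le_iff₀ hl, le_div_iff₀ hl]
    push_cast
    constructor
    · nlinarith [mul_le_mul_of_nonneg_right hw hδ.le, mul_le_mul_of_nonneg_right hKr hδ.le]
    · nlinarith [mul_nonneg hw0 hδ.le]
  refine (measure_mono hsub).trans ((measure_biUnion_finset_le _ _).trans ?_)
  simp only [Real.volume_Ico, add_sub_cancel_left, Finset.sum_const, nsmul_eq_mul]
  rw [← ENNReal.ofReal_natCast, ← ENNReal.ofReal_mul (by positivity)]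
  apply ENNReal.ofReal_le_ofReal
  have hcard : (S.card : ℝ) ≤ 1 / (K * δ) + 3 := by
    rw [hS, Int.card_Icc]
    have h1 := Int.floor_le ((y + 1) / (K * δ))
    have h2 := Int.le_ceil (y / (K * δ))
    have h3 : (y + 1) / (K * δ) = y / (K * δ) + 1 / (K * δ) := by ring
    have h4 : (0 : ℝ) < 1 / (K * δ) := by positivity
    have h5 : (((⌊(y + 1) / (K * δ)⌋ + 1 - (⌈y / (K * δ)⌉ - 2)).toNat : ℕ) : ℝ)
      = ((max (⌊(y + 1) / (K * δ)⌋ + 1 - (⌈y / (K * δ)⌉ - 2)) 0 : ℤ) : ℝ) := by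
      rw [← Int.toNat_eq_max]; norm_cast
    rw [h5]
    push_cast
    apply max_le <;> linarith
  calc (S.card : ℝ) * (2 * δ) ≤ (1 / (K * δ) + 3) * (2 * δ) := by gcongr
    _ = 2 / K + 6 * δ := by field_simp; ring
    _ ≤ 8 / K := by
      have : δ ≤ 1 / K := by rw [le_div_iff₀ (by positivity)]; exact hδK
      have h8 : (8 : ℝ) / K = 2 / K + 6 * (1 / K) := by ring
      rw [h8]; gcongr

lemma key_aux (a : ℕ → ℝ) (ha : ∀ n, 1 ≤ n → 0 < a n) (ham : Monotone a)
    (hgrowth : Tendsto (fun n : ℕ => Real.log (a n) / (n : ℝ)) atTop (nhds 0))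
    (f : ℕ → ℝ → ℝ) (C₁ C₂ : ℝ) (hC₁ : 0 < C₁) (hC₂ : 0 < C₂)
    (hf0 : ∀ n t, 0 < t → 0 ≤ f n t)
    (hmono : ∀ n s t, 0 < s → s ≤ t → f n s ≤ f n t)
    (hfgap : ∀ n t, 0 < t → C₁ * t ≤ f (n + 1) t - f n t)
    (hup : ∀ n t, 0 < t → f n t ≤ C₂ * t * a n)
    (α β k ε : ℝ) (hα : 0 < α) (hαβ : α ≤ β) (hk : 0 ≤ k) (hε : 0 < ε) :
    ∃ F : Set ℝ, MeasurableSet F ∧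
      (∀ y : ℝ, volume (F ∩ Set.Icc y (y + 1)) ≤ ENNReal.ofReal ε) ∧
      ∀ x t : ℝ, |x| ≤ k → α ≤ t → t ≤ β → ∃ n, x + f n t ∈ F := by
  classical
  obtain ⟨K₀, hK₀⟩ := exists_nat_ge (8 / ε)
  obtain ⟨K, hK2, hKε⟩ : ∃ K : ℕ, 2 ≤ K ∧ 8 / ε ≤ K :=
    ⟨K₀ + 2, by omega, by push_cast; linarith⟩
  have hK : 0 < K := by omega
  have hKr : (2 : ℝ) ≤ K := by exact_mod_cast hK2
  set δ : ℝ := min (C₁ * α) 1 / K with hδdef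
  have hm : 0 < min (C₁ * α) 1 := lt_min (by positivity) one_pos
  have hδ : 0 < δ := by positivity
  have hδK : δ * K = min (C₁ * α) 1 := by rw [hδdef]; field_simp
  have hβ : 0 < β := hα.trans_le hαβ
  set r : ℝ := 1 - 1 / (K : ℝ) with hr
  have hKi : 1 / (K : ℝ) ≤ 1 / 2 := one_div_le_one_div_of_le two_pos hKr
  have hKi0 : 0 < 1 / (K : ℝ) := by positivity
  set M : ℕ := ⌈k / δ⌉₊ + 1 with hM
  obtain ⟨N, hN⟩ := growth_aux a ha hgrowth r (by linarith) (by linarith) (2 * M + 1)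
    (C₂ * β / δ) (by positivity) (by positivity)
  set g : ℕ → ℝ → ℤ := fun n t => ⌊f n t / δ⌋ with hg
  have hg0 : ∀ n t, 0 < t → 0 ≤ g n t := fun n t ht =>
    Int.floor_nonneg.2 (div_nonneg (hf0 n t ht) hδ.le)
  have hgm : ∀ n s t, 0 < s → s ≤ t → g n s ≤ g n t := fun n s t hs hst =>
    Int.floor_le_floor (by have := hmono n s t hs hst; gcongr)
  have hgg : ∀ n t, α ≤ t → g n t + K ≤ g (n + 1) t := by
    intro n t ht
    rw [hg]
    simp only
    rw [Int.le_floor]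
    push_cast
    have h1 := Int.floor_le (f n t / δ)
    have h2 := hfgap n t (hα.trans_le ht)
    have h3 : δ * K ≤ C₁ * t := by
      rw [hδK]; exact (min_le_left _ _).trans (by gcongr)
    have h4 : (K : ℝ) ≤ (f (n + 1) t - f n t) / δ := by
      rw [le_div_iff₀ hδ]; linarith
    rw [sub_div] at h4
    linarith
  set S : ℝ → ℤ := fun t => ∑ n ∈ Finset.range N, g n t with hS
  set L : ℤ := N * ⌊C₂ * β / δ * a N⌋ with hL
  have hSL : ∀ t, α ≤ t → t ≤ β → S t ∈ Finset.Icc 0 L := by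
    intro t h1 h2
    have ht : 0 < t := hα.trans_le h1
    rw [Finset.mem_Icc]
    refine ⟨Finset.sum_nonneg fun n _ => hg0 n t ht, ?_⟩
    have : S t ≤ (Finset.range N).card • ⌊C₂ * β / δ * a N⌋ := by
      refine Finset.sum_le_card_nsmul _ _ _ fun n hn => ?_
      rw [Finset.mem_range] at hn
      apply Int.floor_le_floor
      have e1 : f n t ≤ C₂ * β * a N := by
        have haN := ha N (by omega)
        calc f n t ≤ C₂ * t * a n := hup n t ht
          _ ≤ C₂ * t * a N := by have := ham hn.le; gcongr
          _ ≤ C₂ * β * a N := by gcongr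
      calc f n t / δ ≤ C₂ * β * a N / δ := by gcongr
        _ = _ := by ring
    simpa [hL] using this
  have hSinj : ∀ s t, α ≤ s → α ≤ t → S s = S t → ∀ n < N, g n s = g n t := by
    have main : ∀ s t, α ≤ s → s ≤ t → S s = S t → ∀ n < N, g n s = g n t := by
      intro s t hs hst h n hn
      exact (Finset.sum_eq_sum_iff_of_le (fun n _ => hgm n s t (hα.trans_le hs) hst)).1 h n
        (Finset.mem_range.2 hn)
    intro s t hs ht h n hn
    rcases le_total s t with hst | hst
    · exact main s t hs hst h n hn
    · exact (main t s ht hst h.symm n hn).symm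
  have htt : ∀ z : ℤ, ∃ t, α ≤ t ∧ ((∃ u, α ≤ u ∧ u ≤ β ∧ S u = z) → S t = z) := by
    intro z
    by_cases h : ∃ u, α ≤ u ∧ u ≤ β ∧ S u = z
    · obtain ⟨u, h1, h2, h3⟩ := h
      exact ⟨u, h1, fun _ => h3⟩
    · exact ⟨α, le_rfl, fun h' => absurd h' h⟩
  choose tt htt1 htt2 using htt
  have hKz : (0 : ℤ) < K := by exact_mod_cast hK
  have hlt : ∀ z : ℤ, (z % K).toNat < K := fun z => by
    have h1 := Int.emod_lt_of_pos z hKz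
    have h2 := Int.emod_nonneg z hKz.ne'
    omega
  obtain ⟨ω, hω⟩ := hit_aux ((Finset.Icc (-(M : ℤ)) M) ×ˢ (Finset.Icc 0 L)) N K hK
    (fun q n => (q.1 + g n (tt q.2)) / K)
    (fun q n => ⟨((q.1 + g n (tt q.2)) % K).toNat, hlt _⟩)
    (by
      intro q _
      apply StrictMono.injective
      apply strictMono_nat_of_lt_succ
      intro n
      have h1 := hgg n (tt q.2) (htt1 q.2)
      have h2 : (q.1 + g n (tt q.2)) / K + 1 = (q.1 + g n (tt q.2) + K) / K := by
        rw [Int.add_ediv_of_dvd_right (dvd_refl _), Int.ediv_self hKz.ne']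
      have h3 : (q.1 + g n (tt q.2) + K) / K ≤ (q.1 + g (n + 1) (tt q.2)) / (K : ℤ) :=
        Int.ediv_le_ediv hKz (by omega)
      omega)
    (by
      refine lt_of_le_of_lt ?_ hN
      rw [Finset.card_product, Int.card_Icc, Int.card_Icc]
      have e1 : ((M : ℤ) + 1 - -(M : ℤ)).toNat = 2 * M + 1 := by omega
      rw [e1]
      push_cast
      have hL0 : 0 ≤ L := by
        have := hSL α le_rfl hαβ
        rw [Finset.mem_Icc] at this
        omega
      have e2 : (((L + 1 - 0).toNat : ℕ) : ℝ) = L + 1 := by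
        have : (((L + 1 - 0).toNat : ℕ) : ℤ) = L + 1 := by omega
        exact_mod_cast congrArg (Int.cast : ℤ → ℝ) this
      rw [e2]
      have e3 : (L : ℝ) ≤ N * (C₂ * β / δ * a N) := by
        rw [hL]
        push_cast
        have := Int.floor_le (C₂ * β / δ * a N)
        gcongr
      have : 0 < r := by linarith
      gcongr)
  refine ⟨⋃ c : ℤ, Set.Ico (((c * K + (ω c : ℕ) : ℤ) : ℝ) * δ)
    (((c * K + (ω c : ℕ) : ℤ) : ℝ) * δ + 2 * δ),
    MeasurableSet.iUnion fun _ => measurableSet_Ico, ?_, ?_⟩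
  · intro y
    refine (density_aux K hK δ hδ (hδK.trans_le (min_le_right _ _)) ω y).trans ?_
    apply ENNReal.ofReal_le_ofReal
    rw [div_le_iff₀ (by positivity)]
    rw [div_le_iff₀ hε] at hKε
    linarith
  · intro x t hx h1 h2
    set i : ℤ := ⌊x / δ⌋ with hi
    have hiM : i ∈ Finset.Icc (-(M : ℤ)) M := by
      rw [abs_le] at hx
      have q1 : x / δ ≤ k / δ := by gcongr; exact hx.2
      have q2 : -(k / δ) ≤ x / δ := by rw [← neg_div]; gcongr; exact hx.1
      have q3 := Nat.le_ceil (k / δ)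
      have q4 := Int.floor_le (x / δ)
      have q5 := Int.lt_floor_add_one (x / δ)
      rw [Finset.mem_Icc]
      constructor
      · have : (-(M : ℤ) : ℝ) ≤ (i : ℝ) := by rw [hM]; push_cast; linarith
        exact_mod_cast this
      · have : (i : ℝ) ≤ (M : ℤ) := by rw [hM]; push_cast; linarith
        exact_mod_cast this
    obtain ⟨n, hn, hωn⟩ := hω (i, S t) (Finset.mem_product.2 ⟨hiM, hSL t h1 h2⟩)
    have hgn : g n (tt (S t)) = g n t :=
      hSinj _ _ (htt1 _) h1 (htt2 _ ⟨t, h1, h2, rfl⟩) n hn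
    simp only [hgn] at hωn
    refine ⟨n, Set.mem_iUnion.2 ⟨(i + g n t) / K, ?_⟩⟩
    rw [hωn]
    have e : (i + g n t) / K * K + (((i + g n t) % K).toNat : ℤ) = i + g n t := by
      rw [Int.toNat_of_nonneg (Int.emod_nonneg _ hKz.ne')]
      exact Int.ediv_mul_add_emod _ _
    simp only [e]
    push_cast
    have q4 := Int.floor_le (x / δ)
    have q5 := Int.lt_floor_add_one (x / δ)
    have q6 := Int.floor_le (f n t / δ)
    have q7 := Int.lt_floor_add_one (f n t / δ)
    rw [le_div_iff₀ hδ] at q4 q6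
    rw [div_lt_iff₀ hδ] at q5 q7
    simp only [hi, hg]
    constructor <;> linarith



/-- **Large sets avoiding generalized (non-linear) copies of a sequence.**
If `a` is of class (A) and `φ : ℕ × (0,∞) → (0,∞)` is increasing in `t` for each `n`
and satisfies `C₁ t ≤ φ (n+1) t * a (n+1) - φ n t * a n` and `φ n t ≤ C₂ t`, then for every
`0 ≤ p < 1` there is a measurable `E ⊆ ℝ` meeting every unit interval in measure at least `p`
and containing no set `{x + φ n t * a n : n ∈ ℕ}` with `x ∈ ℝ`, `t > 0`. -/
theorem large_set_no_generalized_copy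
    (a : ℕ → ℝ) (h0 : a 0 = 0) (hgap : ∀ n : ℕ, 1 ≤ a (n + 1) - a n)
    (hgrowth : Tendsto (fun n : ℕ => Real.log (a n) / (n : ℝ)) atTop (nhds 0))
    (φ : ℕ → ℝ → ℝ)
    (hφpos : ∀ n : ℕ, ∀ t : ℝ, 0 < t → 0 < φ n t)
    (hφmono : ∀ n : ℕ, StrictMonoOn (φ n) (Set.Ioi (0 : ℝ)))
    (C₁ C₂ : ℝ) (hC₁ : 0 < C₁) (hC₂ : 0 < C₂)
    (hφgap : ∀ n : ℕ, ∀ t : ℝ, 0 < t → C₁ * t ≤ φ (n + 1) t * a (n + 1) - φ n t * a n)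
    (hφup : ∀ n : ℕ, ∀ t : ℝ, 0 < t → φ n t ≤ C₂ * t)
    (p : ℝ) (hp0 : 0 ≤ p) (hp1 : p < 1) :
    ∃ E : Set ℝ, MeasurableSet E ∧
      (∀ x : ℝ, ENNReal.ofReal p ≤ volume (E ∩ Set.Icc x (x + 1))) ∧
      (∀ x t : ℝ, 0 < t → ¬ (Set.range (fun n : ℕ => x + φ n t * a n) ⊆ E)) := by
  have ha0 : ∀ n, 0 ≤ a n := by
    intro n
    induction n with
    | zero => exact h0.ge
    | succ n ih => linarith [hgap n]
  have ha : ∀ n, 1 ≤ n → 0 < a n := by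
    intro n hn
    obtain ⟨m, rfl⟩ := Nat.exists_eq_add_of_le' hn
    linarith [hgap m, ha0 m]
  have ham : Monotone a := monotone_nat_of_le_succ fun n => by linarith [hgap n]
  have key := fun k : ℕ => key_aux a ha ham hgrowth (fun n t => φ n t * a n) C₁ C₂ hC₁ hC₂
    (fun n t ht => mul_nonneg (hφpos n t ht).le (ha0 n))
    (fun n s t hs hst => mul_le_mul_of_nonneg_right
      ((hφmono n).monotoneOn hs (hs.trans_le hst) hst) (ha0 n))
    hφgap (fun n t ht => mul_le_mul_of_nonneg_right (hφup n t ht) (ha0 n))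
    (1 / ((k : ℝ) + 1)) ((k : ℝ) + 1) k ((1 - p) / 2 / 2 ^ k) (by positivity)
    (by
      have hk : (0 : ℝ) ≤ k := k.cast_nonneg
      rw [div_le_iff₀ (by positivity)]
      nlinarith) k.cast_nonneg (by have : 0 < 1 - p := by linarith
                                   positivity)
  choose F hFm hFd hFh using key
  have hUm : MeasurableSet (⋃ k, F k) := MeasurableSet.iUnion hFm
  refine ⟨(⋃ k, F k)ᶜ, hUm.compl, ?_, ?_⟩
  · intro x
    have hsmall : volume ((⋃ k, F k) ∩ Set.Icc x (x + 1)) ≤ ENNReal.ofReal (1 - p) := by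
      rw [Set.iUnion_inter]
      refine (measure_iUnion_le _).trans ?_
      refine (ENNReal.tsum_le_tsum fun k => hFd k x).trans ?_
      rw [← ENNReal.ofReal_tsum_of_nonneg (fun k => by
        have : 0 < 1 - p := by linarith
        positivity) (summable_geometric_two' (1 - p)), tsum_geometric_two']
    have hsplit := measure_inter_add_sdiff (μ := volume) (Set.Icc x (x + 1)) hUm
    rw [Real.volume_Icc, add_sub_cancel_left, Set.inter_comm, Set.sdiff_eq,
      Set.inter_comm (Set.Icc x (x + 1))] at hsplit
    have h1 : ENNReal.ofReal (1 - p) + ENNReal.ofReal p ≤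
        ENNReal.ofReal (1 - p) + volume ((⋃ k, F k)ᶜ ∩ Set.Icc x (x + 1)) := by
      rw [← ENNReal.ofReal_add (by linarith) hp0, sub_add_cancel, ← hsplit]
      gcongr
    exact (ENNReal.add_le_add_iff_left ENNReal.ofReal_ne_top).1 h1
  · intro x t ht hsub
    obtain ⟨k, hk⟩ := exists_nat_ge (max |x| (max t (1 / t)))
    have k1 : |x| ≤ k := (le_max_left _ _).trans hk
    have k2 : t ≤ k := ((le_max_left _ _).trans (le_max_right _ _)).trans hk
    have k3 : 1 / t ≤ k := ((le_max_right _ _).trans (le_max_right _ _)).trans hk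
    obtain ⟨n, hn⟩ := hFh k x t k1 (by
      rw [div_le_iff₀ ht] at k3
      rw [div_le_iff₀ (by positivity)]
      nlinarith) (by linarith)
    exact hsub ⟨n, rfl⟩ (Set.mem_iUnion.2 ⟨k, hn⟩)
end

section
/- Let A = {a_n : n ∈ ℕ} be a real sequence of class (A), with counting function A(t) = #(A ∩ [0, t]). For all real numbers 0 < a < b, every p with 0 ≤ p < 1, and every ε > 0, there is N₀ ∈ ℕ such that for all integers N ≥ N₀ there is a Lebesgue measurable set E ⊆ [−N, N] with the following properties: (i) for every integer m with −N ≤ m ≤ N − 1, one has |E ∩ [m, m+1]| ≥ p; and (ii) if B denotes the set of all x ∈ [−N, N] for which there exists t ∈ [a, b] such that (x + tA) ∩ [−N, N] ⊆ E and #((x + tA) ∩ [−N, N]) ≥ A(N/(10b)), then |B| < ε. -/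
open MeasureTheory Filter

lemma fal_count {ι G : Type*} [Fintype ι] [DecidableEq ι] [Fintype G] (L J : ℕ) (hL : 1 ≤ L)
    (m : G → Fin J → ι) (hm : ∀ g, Function.Injective (m g)) (k : G → Fin J → Fin L)
    (hc : (Fintype.card G : ℝ) * (1 - 1 / (L : ℝ)) ^ J < 1) :
    ∃ c : ι → Fin L, ∀ g, ∃ j, c (m g j) = k g j := by
  classical
  by_contra hcon
  push Not at hcon
  have hL0 : (0 : ℝ) < L := by exact_mod_cast hL
  have hL1 : (1 : ℝ) ≤ L := by exact_mod_cast hL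
  let S : G → Finset (ι → Fin L) := fun g =>
    Fintype.piFinset (fun i => Finset.univ.filter (fun v => ∀ j, m g j = i → v ≠ k g j))
  have hcov : (Finset.univ : Finset (ι → Fin L)) ⊆ Finset.univ.biUnion S := by
    intro c _
    obtain ⟨g, hg⟩ := hcon c
    refine Finset.mem_biUnion.2 ⟨g, Finset.mem_univ _, ?_⟩
    refine Fintype.mem_piFinset.2 fun i => ?_
    simp only [Finset.mem_filter, Finset.mem_univ, true_and]
    rintro j rfl
    exact hg j
  have hS : ∀ g, ((S g).card : ℝ) ≤ (L : ℝ) ^ (Fintype.card ι) * (1 - 1 / (L : ℝ)) ^ J := by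
    intro g
    have h1 : ((S g).card : ℝ) ≤ ∏ i : ι, ((L : ℝ) *
        (if i ∈ Finset.univ.image (m g) then (1 - 1 / (L : ℝ)) else 1)) := by
      rw [Fintype.card_piFinset]
      push_cast
      refine Finset.prod_le_prod (fun i _ => by positivity) fun i _ => ?_
      split_ifs with hi
      · obtain ⟨j, -, rfl⟩ := Finset.mem_image.1 hi
        have : (Finset.univ.filter (fun v => ∀ j', m g j' = m g j → v ≠ k g j'))
            ⊆ Finset.univ.erase (k g j) := by
          intro v hv
          simp only [Finset.mem_filter, Finset.mem_univ, true_and] at hv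
          simp [hv j rfl]
        have h2 := Finset.card_le_card this
        rw [Finset.card_erase_of_mem (Finset.mem_univ _), Finset.card_univ, Fintype.card_fin] at h2
        have h3 : (L : ℝ) * (1 - 1 / (L : ℝ)) = ((L - 1 : ℕ) : ℝ) := by
          push_cast [hL]
          field_simp
        rw [h3]
        exact_mod_cast h2
      · rw [mul_one]
        have h2 := Finset.card_filter_le (Finset.univ : Finset (Fin L))
          (fun v => ∀ j, m g j = i → v ≠ k g j)
        rw [Finset.card_univ, Fintype.card_fin] at h2
        exact_mod_cast h2
    refine h1.trans (le_of_eq ?_)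
    rw [Finset.prod_mul_distrib, Finset.prod_const, Finset.card_univ, Finset.prod_ite_mem,
      Finset.univ_inter, Finset.prod_const, Finset.card_image_of_injective _ (hm g),
      Finset.card_univ, Fintype.card_fin]
  have hcard := (Finset.card_le_card hcov).trans Finset.card_biUnion_le
  rw [Finset.card_univ, Fintype.card_fun, Fintype.card_fin] at hcard
  have hcard' : (L : ℝ) ^ (Fintype.card ι) ≤ ∑ g, ((S g).card : ℝ) := by exact_mod_cast hcard
  have h4 : ∑ g, ((S g).card : ℝ) ≤
      Fintype.card G * ((L : ℝ) ^ (Fintype.card ι) * (1 - 1 / (L : ℝ)) ^ J) := by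
    refine (Finset.sum_le_sum fun g _ => hS g).trans (le_of_eq ?_)
    simp
  have hpos : (0 : ℝ) < (L : ℝ) ^ (Fintype.card ι) := by positivity
  nlinarith

lemma fal_count_int {G : Type*} [Fintype G] (L J : ℕ) (hL : 1 ≤ L)
    (m : G → Fin J → ℤ) (hm : ∀ g, Function.Injective (m g)) (k : G → Fin J → Fin L)
    (hc : (Fintype.card G : ℝ) * (1 - 1 / (L : ℝ)) ^ J < 1) :
    ∃ c : ℤ → Fin L, ∀ g, ∃ j, c (m g j) = k g j := by
  classical
  let T : Finset ℤ := Finset.univ.biUnion (fun g => Finset.univ.image (m g))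
  have hT : ∀ g j, m g j ∈ T := fun g j =>
    Finset.mem_biUnion.2 ⟨g, Finset.mem_univ _, Finset.mem_image_of_mem _ (Finset.mem_univ _)⟩
  obtain ⟨c, hc'⟩ := fal_count (ι := T) L J hL (fun g j => ⟨m g j, hT g j⟩)
    (fun g i j h => hm g (by simpa using h)) k hc
  refine ⟨fun z => if h : z ∈ T then c ⟨z, h⟩ else ⟨0, hL⟩, fun g => ?_⟩
  obtain ⟨j, hj⟩ := hc' g
  exact ⟨j, by simpa [hT g j] using hj⟩

lemma fal_gap (a : ℕ → ℝ) (hgap : ∀ n : ℕ, 1 ≤ a (n + 1) - a n) (n d : ℕ) :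
    a n + d ≤ a (n + d) := by
  induction d with
  | zero => simp
  | succ d ih =>
    have := hgap (n + d)
    push_cast
    rw [← add_assoc n d 1]
    linarith

lemma fal_core (a : ℕ → ℝ) (h0 : a 0 = 0) (hgap : ∀ n : ℕ, 1 ≤ a (n + 1) - a n)
    (s r : ℝ) (hs : 0 < s) (hsr : s < r) (N L D J k : ℕ) (hN : 1 ≤ N) (hL : 1 ≤ L)
    (hD : 1 ≤ s * D) (hJ : D * J ≤ k) (ha : ∀ n < k, a n ≤ N / (10 * r))
    (hc : 10 * (L : ℝ) ^ 2 * (N : ℝ) ^ 2 * (1 - 1 / (L : ℝ)) ^ J < 1) :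
    ∃ c : ℤ → Fin L, ∀ x ∈ Set.Icc (-(N : ℝ)) N, ∀ t ∈ Set.Icc s r, ∃ n < k, ∃ m : ℤ,
      |x + t * a n - (m + ((c m : ℕ) + 1 / 2) / L)| < 2 / L := by
  have hr : 0 < r := hs.trans hsr
  have hL0 : (0 : ℝ) < L := by exact_mod_cast hL
  have hL1 : (1 : ℝ) ≤ L := by exact_mod_cast hL
  have hN1 : (1 : ℝ) ≤ N := by exact_mod_cast hN
  have hN0 : (0 : ℝ) < N := by linarith
  have hDpos : 0 < D := by
    rcases Nat.eq_zero_or_pos D with h | h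
    · subst h; norm_num at hD
    · exact h
  have hann : ∀ n, 0 ≤ a n := fun n => by
    have := fal_gap a hgap 0 n
    rw [h0, zero_add, zero_add] at this
    exact (Nat.cast_nonneg n).trans this
  set η : ℝ := r / (L * N) with hη
  have hη0 : 0 < η := by positivity
  let G := (Finset.Icc (-(2 * L * N : ℕ) : ℤ) (2 * L * N : ℕ)) × Fin (L * N + 1)
  let y : G → ℕ → ℝ := fun g j => ((g.1 : ℤ) : ℝ) / (2 * L) + (s + (g.2 : ℕ) * η) * a (D * j)
  have hcardG : (Fintype.card G : ℝ) ≤ 10 * (L : ℝ) ^ 2 * (N : ℝ) ^ 2 := by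
    have : Fintype.card G = (4 * L * N + 1) * (L * N + 1) := by
      simp only [G, Fintype.card_prod, Fintype.card_coe, Int.card_Icc, Fintype.card_fin]
      congr 1
      have h4 : 4 * L * N = 2 * (2 * L * N) := by ring
      omega
    rw [this]
    push_cast
    have : 1 ≤ (L : ℝ) * N := by nlinarith
    nlinarith
  have hstep : ∀ g : G, ∀ i j : ℕ, i < j → y g i + 1 ≤ y g j := by
    intro g i j hij
    obtain ⟨d, rfl⟩ := Nat.exists_eq_add_of_lt hij
    have h1 := fal_gap a hgap (D * i) (D * (d + 1))
    have e : D * i + D * (d + 1) = D * (i + d + 1) := by ring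
    rw [e] at h1
    have h2 : (D : ℝ) ≤ ((D * (d + 1) : ℕ) : ℝ) := by
      exact_mod_cast Nat.le_mul_of_pos_right D (Nat.succ_pos d)
    have h3 : s ≤ s + (g.2 : ℕ) * η := by
      have : 0 ≤ ((g.2 : ℕ) : ℝ) * η := by positivity
      linarith
    have h4 : 1 ≤ (s + (g.2 : ℕ) * η) * (a (D * (i + d + 1)) - a (D * i)) :=
      hD.trans (mul_le_mul h3 (by linarith) (by positivity) (by linarith))
    simp only [y]
    linarith
  have hinj : ∀ g : G, Function.Injective (fun j : Fin J => ⌊y g j⌋) := by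
    have key : ∀ g : G, ∀ i j : ℕ, i < j → ⌊y g i⌋ < ⌊y g j⌋ := by
      intro g i j hij
      have := Int.floor_le_floor (hstep g i j hij)
      rw [Int.floor_add_one] at this
      omega
    intro g i j h
    rcases lt_trichotomy (i : ℕ) j with h' | h' | h'
    · exact absurd h (key g _ _ h').ne
    · exact Fin.ext h'
    · exact absurd h (key g _ _ h').ne'
  have hfr : ∀ z : ℝ, ⌊(L : ℝ) * Int.fract z⌋₊ < L := by
    intro z
    rw [Nat.floor_lt (mul_nonneg hL0.le (Int.fract_nonneg z))]
    have := Int.fract_lt_one z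
    nlinarith
  have hq : 0 ≤ (1 - 1 / (L : ℝ)) ^ J := by
    apply pow_nonneg
    rw [sub_nonneg, div_le_one hL0]
    exact hL1
  obtain ⟨c, hcc⟩ := fal_count_int (G := G) L J hL (fun g j => ⌊y g j⌋) hinj
    (fun g j => ⟨⌊(L : ℝ) * Int.fract (y g j)⌋₊, hfr _⟩)
    ((mul_le_mul_of_nonneg_right hcardG hq).trans_lt hc)
  refine ⟨c, fun x hx t ht => ?_⟩
  have hx1 : ⌊2 * L * x⌋ ∈ Finset.Icc (-(2 * L * N : ℕ) : ℤ) (2 * L * N : ℕ) := by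
    rw [Finset.mem_Icc]
    constructor
    · rw [Int.le_floor]
      push_cast
      nlinarith [hx.1]
    · have : ⌊2 * L * x⌋ ≤ ⌊(((2 * L * N : ℕ) : ℤ) : ℝ)⌋ := by
        apply Int.floor_le_floor
        push_cast
        nlinarith [hx.2]
      rwa [Int.floor_intCast] at this
  have htη : 0 ≤ (t - s) / η := div_nonneg (by linarith [ht.1]) hη0.le
  have ht1 : ⌊(t - s) / η⌋₊ < L * N + 1 := by
    rw [Nat.floor_lt htη, div_lt_iff₀ hη0]
    push_cast
    have : (L : ℝ) * N * η = r := by rw [hη]; field_simp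
    nlinarith [ht.2]
  obtain ⟨j, hj⟩ := hcc (⟨_, hx1⟩, ⟨_, ht1⟩)
  set g : G := (⟨_, hx1⟩, ⟨_, ht1⟩) with hg
  have hnk : D * (j : ℕ) < k := lt_of_lt_of_le (Nat.mul_lt_mul_of_pos_left j.2 hDpos) hJ
  refine ⟨D * j, hnk, ⌊y g j⌋, ?_⟩
  rw [hj]
  simp only
  -- rounding of `x`
  have e1 : |x - (⌊2 * L * x⌋ : ℝ) / (2 * L)| ≤ 1 / (2 * L) := by
    have h1 := Int.floor_le (2 * L * x)
    have h2 := Int.lt_floor_add_one (2 * L * x)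
    have h3 : x - (⌊2 * L * x⌋ : ℝ) / (2 * L) = (2 * L * x - ⌊2 * L * x⌋) / (2 * L) := by
      field_simp
    rw [h3, abs_of_nonneg (div_nonneg (by linarith) (by positivity))]
    gcongr
    linarith
  have e2 : |(t - (s + (⌊(t - s) / η⌋₊ : ℝ) * η)) * a (D * j)| ≤ 1 / (10 * L) := by
    have h1 := Nat.floor_le htη
    have h2 := Nat.lt_floor_add_one ((t - s) / η)
    rw [le_div_iff₀ hη0] at h1
    rw [div_lt_iff₀ hη0] at h2
    have h3 := ha _ hnk
    rw [abs_of_nonneg (mul_nonneg (by linarith) (hann _))]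
    calc _ ≤ η * (N / (10 * r)) := by
          apply mul_le_mul (by linarith) h3 (hann _) hη0.le
      _ = 1 / (10 * L) := by rw [hη]; field_simp
  have e3 : |y g j - (⌊y g j⌋ + ((⌊(L : ℝ) * Int.fract (y g j)⌋₊ : ℝ) + 1 / 2) / L)|
      ≤ 1 / (2 * L) := by
    have hf := mul_nonneg hL0.le (Int.fract_nonneg (y g j))
    have h1 := Nat.floor_le hf
    have h2 := Nat.lt_floor_add_one ((L : ℝ) * Int.fract (y g j))
    have h3 : y g j - (⌊y g j⌋ + ((⌊(L : ℝ) * Int.fract (y g j)⌋₊ : ℝ) + 1 / 2) / L)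
        = (L * Int.fract (y g j) - ⌊(L : ℝ) * Int.fract (y g j)⌋₊ - 1 / 2) / L := by
      have : (⌊y g j⌋ : ℝ) = y g j - Int.fract (y g j) := by
        rw [Int.self_sub_fract]
      rw [this]
      field_simp
      ring
    rw [h3, abs_div, abs_of_pos hL0, div_le_div_iff₀ hL0 (by positivity)]
    have : |(L : ℝ) * Int.fract (y g j) - ⌊(L : ℝ) * Int.fract (y g j)⌋₊ - 1 / 2| ≤ 1 / 2 := by
      rw [abs_le]
      constructor <;> linarith
    nlinarith
  have e4 : x + t * a (D * j) = y g j + ((x - (⌊2 * L * x⌋ : ℝ) / (2 * L)) +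
      (t - (s + (⌊(t - s) / η⌋₊ : ℝ) * η)) * a (D * j)) := by
    simp only [y, hg]
    ring
  have e5 : (1 : ℝ) / (2 * L) + 1 / (10 * L) + 1 / (2 * L) < 2 / L := by
    rw [show (1 : ℝ) / (2 * L) + 1 / (10 * L) + 1 / (2 * L) = (11 / 10) / L by field_simp; norm_num]
    gcongr
    norm_num
  rw [e4, add_sub_right_comm]
  refine lt_of_le_of_lt ((abs_add_le _ _).trans (add_le_add e3 ((abs_add_le _ _).trans
    (add_le_add e1 e2)))) ?_
  linarith

lemma fal_growth (a : ℕ → ℝ)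
    (hgrowth : Tendsto (fun n : ℕ => Real.log (a n) / (n : ℝ)) atTop (nhds 0))
    (r : ℝ) (hr : 0 < r) (L D : ℕ) (hL : 2 ≤ L) (hD : 0 < D) :
    ∃ N₀ : ℕ, 1 ≤ N₀ ∧ ∀ N : ℕ, N₀ ≤ N → ∀ k : ℕ, (∀ n, n < k ↔ a n ≤ N / (10 * r)) →
      10 * (L : ℝ) ^ 2 * (N : ℝ) ^ 2 * (1 - 1 / (L : ℝ)) ^ (k / D) < 1 := by
  have hL2 : (2 : ℝ) ≤ L := by exact_mod_cast hL
  have hD0 : (0 : ℝ) < D := by exact_mod_cast hD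
  set q : ℝ := 1 - 1 / (L : ℝ) with hq
  have hLi : 1 / (L : ℝ) ≤ 1 / 2 := by gcongr
  have hLi0 : 0 < 1 / (L : ℝ) := by positivity
  have hq0 : 0 < q := by linarith
  have hq1 : q < 1 := by linarith
  set θ : ℝ := -Real.log q with hθ
  have hθ0 : 0 < θ := by have := Real.log_neg hq0 hq1; linarith
  set κ : ℝ := θ / (3 * D) with hκ
  have hκ0 : 0 < κ := by positivity
  obtain ⟨n0, hn0⟩ := eventually_atTop.1 (hgrowth.eventually (gt_mem_nhds hκ0))
  set C : ℝ := θ + 3 * Real.log (10 * r) + Real.log (10 * (L : ℝ) ^ 2) with hC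
  obtain ⟨N1, hN1⟩ := exists_nat_gt (10 * r * a (n0 + 1))
  obtain ⟨N2, hN2⟩ := exists_nat_gt (Real.exp C)
  refine ⟨N1 + N2 + 1, by omega, fun N hN k hk => ?_⟩
  have hNpos : (0 : ℝ) < N := by exact_mod_cast (by omega : 0 < N)
  have hNN1 : (N1 : ℝ) ≤ N := by exact_mod_cast (by omega : N1 ≤ N)
  have hNN2 : (N2 : ℝ) ≤ N := by exact_mod_cast (by omega : N2 ≤ N)
  have hkn : n0 + 1 < k := by
    rw [hk, le_div_iff₀ (by positivity)]
    linarith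
  have hkpos : (0 : ℝ) < k := by exact_mod_cast (by omega : 0 < k)
  have hlog := hn0 k (by omega)
  rw [div_lt_iff₀ hkpos] at hlog
  have hak : (N : ℝ) / (10 * r) < a k := by
    by_contra h
    exact lt_irrefl k ((hk k).2 (not_lt.1 h))
  have h1 : Real.log N - Real.log (10 * r) ≤ Real.log (a k) := by
    rw [← Real.log_div hNpos.ne' (by positivity)]
    exact Real.log_le_log (by positivity) hak.le
  have hJ : (k : ℝ) / D - 1 ≤ ((k / D : ℕ) : ℝ) := by
    have : k < D * (k / D + 1) := Nat.lt_mul_div_succ k hD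
    have h' : (k : ℝ) ≤ D * ((k / D : ℕ) + 1) := by exact_mod_cast this.le
    rw [sub_le_iff_le_add, div_le_iff₀ hD0]
    linarith
  have hCN : C < Real.log N := by
    rw [Real.lt_log_iff_exp_lt hNpos]
    linarith
  have h2 : 3 * κ * k = θ * (k / D) := by
    rw [hκ]; field_simp
  rw [← Real.log_neg_iff (by positivity), Real.log_mul (by positivity) (by positivity),
    Real.log_mul (by positivity) (by positivity), Real.log_pow, Real.log_pow]
  have h3 : ((k / D : ℕ) : ℝ) * Real.log q ≤ -(θ * (k / D - 1)) := by
    have : Real.log q = -θ := by rw [hθ]; ring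
    rw [this]
    nlinarith
  push_cast
  linarith

lemma fal_measure (L : ℕ) (hL : 2 ≤ L) (p : ℝ) (hp : 12 ≤ (1 - p) * L)
    (c : ℤ → Fin L) (N : ℕ) (m : ℤ) (hm1 : -(N : ℤ) ≤ m) (hm2 : m ≤ (N : ℤ) - 1) :
    ENNReal.ofReal p ≤ volume ((Set.Icc (-(N : ℝ)) (N : ℝ) \
      ⋃ i : ℤ, Metric.ball ((i : ℝ) + ((c i : ℕ) + 1 / 2) / L) (2 / L)) ∩
        Set.Icc (m : ℝ) ((m : ℝ) + 1)) := by
  have hL2 : (2 : ℝ) ≤ L := by exact_mod_cast hL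
  have hL0 : (0 : ℝ) < L := by linarith
  set b : ℤ → Set ℝ := fun i => Metric.ball ((i : ℝ) + ((c i : ℕ) + 1 / 2) / L) (2 / L) with hb
  have hm1' : -(N : ℝ) ≤ m := by exact_mod_cast hm1
  have hm2' : (m : ℝ) ≤ N - 1 := by exact_mod_cast hm2
  have hsub : Set.Icc (m : ℝ) (m + 1) \ (b (m - 1) ∪ b m ∪ b (m + 1)) ⊆
      (Set.Icc (-(N : ℝ)) (N : ℝ) \ ⋃ i : ℤ, b i) ∩ Set.Icc (m : ℝ) ((m : ℝ) + 1) := by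
    rintro z ⟨hz, hzb⟩
    refine ⟨⟨⟨by linarith [hz.1], by linarith [hz.2]⟩, ?_⟩, hz⟩
    intro hzu
    obtain ⟨i, hi⟩ := Set.mem_iUnion.1 hzu
    have hi' := hi
    simp only [hb, Metric.mem_ball, Real.dist_eq, abs_lt] at hi'
    have hci : ((c i : ℕ) : ℝ) + 1 ≤ L := by exact_mod_cast (c i).2
    have hci0 : (0 : ℝ) ≤ ((c i : ℕ) : ℝ) := Nat.cast_nonneg _
    have q1 : 0 < (((c i : ℕ) : ℝ) + 1 / 2) / L := by positivity
    have q2 : (((c i : ℕ) : ℝ) + 1 / 2) / L < 1 := by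
      rw [div_lt_one hL0]; linarith
    have q3 : 2 / (L : ℝ) ≤ 1 := by rwa [div_le_one hL0]
    have i1 : i < m + 2 := by
      have : (i : ℝ) < m + 2 := by linarith [hz.2, hi'.1]
      exact_mod_cast this
    have i2 : m - 2 < i := by
      have : (m : ℝ) - 2 < i := by linarith [hz.1, hi'.2]
      exact_mod_cast this
    apply hzb
    have : i = m - 1 ∨ i = m ∨ i = m + 1 := by omega
    rcases this with rfl | rfl | rfl
    · exact Or.inl (Or.inl hi)
    · exact Or.inl (Or.inr hi)
    · exact Or.inr hi
  have hvol : ∀ i, volume (b i) = ENNReal.ofReal (4 / L) := by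
    intro i
    rw [hb, Real.volume_ball]
    congr 1
    ring
  have hun : volume (b (m - 1) ∪ b m ∪ b (m + 1)) ≤ ENNReal.ofReal (12 / L) := by
    refine (measure_union_le _ _).trans ?_
    refine (add_le_add (measure_union_le _ _) le_rfl).trans ?_
    rw [hvol, hvol, hvol, ← ENNReal.ofReal_add (by positivity) (by positivity),
      ← ENNReal.ofReal_add (by positivity) (by positivity)]
    apply ENNReal.ofReal_le_ofReal
    apply le_of_eq
    ring
  refine le_trans ?_ (measure_mono hsub)
  refine le_trans ?_ (le_measure_sdiff)
  rw [Real.volume_Icc]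
  refine le_trans ?_ (tsub_le_tsub_left hun _)
  rw [← ENNReal.ofReal_sub _ (by positivity)]
  apply ENNReal.ofReal_le_ofReal
  have : 12 / (L : ℝ) ≤ 1 - p := by rwa [div_le_iff₀ hL0]
  linarith

/-- **The key finitary lemma (Lemma `Claim C`).**
Let `aseq` be of class (A) with counting function `A(t) = #({a n} ∩ [0, t])`. For all
`0 < s < r`, `0 ≤ p < 1` and `ε > 0` there is `N₀` such that for all `N ≥ N₀` there is
a measurable `E ⊆ [-N, N]` with `|E ∩ [m, m+1]| ≥ p` for all integers `-N ≤ m ≤ N - 1`,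
and such that the set `B` of all `x ∈ [-N, N]` for which there is `t ∈ [s, r]` with
`(x + t·A) ∩ [-N, N] ⊆ E` and `#((x + t·A) ∩ [-N, N]) ≥ A(N/(10 r))` has measure `< ε`. -/
theorem finitary_avoidance_lemma
    (aseq : ℕ → ℝ) (h0 : aseq 0 = 0) (hgap : ∀ n : ℕ, 1 ≤ aseq (n + 1) - aseq n)
    (hgrowth : Tendsto (fun n : ℕ => Real.log (aseq n) / (n : ℝ)) atTop (nhds 0))
    (s r : ℝ) (hs : 0 < s) (hsr : s < r)
    (p : ℝ) (hp0 : 0 ≤ p) (hp1 : p < 1)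
    (ε : ℝ) (hε : 0 < ε) :
    ∃ N₀ : ℕ, ∀ N : ℕ, N₀ ≤ N →
      ∃ E : Set ℝ, MeasurableSet E ∧ E ⊆ Set.Icc (-(N : ℝ)) (N : ℝ) ∧
        (∀ m : ℤ, -(N : ℤ) ≤ m → m ≤ (N : ℤ) - 1 →
          ENNReal.ofReal p ≤ volume (E ∩ Set.Icc (m : ℝ) ((m : ℝ) + 1))) ∧
        volume {x ∈ Set.Icc (-(N : ℝ)) (N : ℝ) | ∃ t ∈ Set.Icc s r,
            (Set.range (fun n : ℕ => x + t * aseq n) ∩ Set.Icc (-(N : ℝ)) (N : ℝ) ⊆ E) ∧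
            (Set.range aseq ∩ Set.Icc (0 : ℝ) ((N : ℝ) / (10 * r))).ncard ≤
              (Set.range (fun n : ℕ => x + t * aseq n) ∩ Set.Icc (-(N : ℝ)) (N : ℝ)).ncard}
          < ENNReal.ofReal ε := by
  have hr : 0 < r := hs.trans hsr
  obtain ⟨L1, hL1⟩ := exists_nat_gt (12 / (1 - p))
  set L : ℕ := L1 + 2 with hL
  have hp' : 0 < 1 - p := by linarith
  have hpL : 12 ≤ (1 - p) * (L : ℝ) := by
    rw [div_lt_iff₀ hp'] at hL1
    rw [hL]
    push_cast
    nlinarith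
  obtain ⟨D, hD⟩ := exists_nat_gt (1 / s)
  have hDs : 1 ≤ s * D := by
    rw [div_lt_iff₀ hs] at hD
    linarith
  have hD0 : 0 < D := by
    have : (0 : ℝ) < D := lt_trans (by positivity) hD
    exact_mod_cast this
  obtain ⟨N₀, hN₀, hgr⟩ := fal_growth aseq hgrowth r hr L D (by omega) hD0
  have hmono : StrictMono aseq := strictMono_nat_of_lt_succ fun n => by linarith [hgap n]
  have hann : ∀ n, 0 ≤ aseq n := fun n => by
    rw [← h0]; exact hmono.monotone (Nat.zero_le n)
  refine ⟨N₀, fun N hN => ?_⟩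
  -- the number of terms up to `N / (10 r)`
  obtain ⟨k, hk⟩ : ∃ k : ℕ, ∀ n, n < k ↔ aseq n ≤ N / (10 * r) := by
    classical
    have hex : ∃ n, (N : ℝ) / (10 * r) < aseq n := by
      obtain ⟨n, hn⟩ := exists_nat_gt ((N : ℝ) / (10 * r))
      refine ⟨n, hn.trans_le ?_⟩
      have := fal_gap aseq hgap 0 n
      rwa [h0, zero_add, zero_add] at this
    refine ⟨Nat.find hex, fun n => ⟨fun h => not_lt.1 (Nat.find_min hex h), fun h => ?_⟩⟩
    by_contra h'
    have h1 := Nat.find_spec hex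
    have h2 := hmono.monotone (not_lt.1 h')
    linarith
  have hcard : (Set.range aseq ∩ Set.Icc (0 : ℝ) ((N : ℝ) / (10 * r))).ncard = k := by
    have : Set.range aseq ∩ Set.Icc (0 : ℝ) ((N : ℝ) / (10 * r)) =
        Set.image aseq (Finset.range k) := by
      ext z
      constructor
      · rintro ⟨⟨n, rfl⟩, -, h⟩
        exact ⟨n, by simpa using (hk n).2 h, rfl⟩
      · rintro ⟨n, hn, rfl⟩
        exact ⟨⟨n, rfl⟩, hann n, (hk n).1 (by simpa using hn)⟩
    rw [this, Set.ncard_image_of_injective _ hmono.injective, Set.ncard_coe_finset,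
      Finset.card_range]
  obtain ⟨c, hc⟩ := fal_core aseq h0 hgap s r hs hsr N L D (k / D) k (hN₀.trans hN) (by omega)
    hDs (Nat.mul_div_le k D) (fun n hn => (hk n).1 hn) (hgr N hN k hk)
  refine ⟨Set.Icc (-(N : ℝ)) (N : ℝ) \
      ⋃ i : ℤ, Metric.ball ((i : ℝ) + ((c i : ℕ) + 1 / 2) / L) (2 / L),
    measurableSet_Icc.diff (MeasurableSet.iUnion fun i => measurableSet_ball),
    Set.sdiff_subset, fun m hm1 hm2 => fal_measure L (by omega) p hpL c N m hm1 hm2, ?_⟩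
  refine lt_of_le_of_lt (le_of_eq ?_) (ENNReal.ofReal_pos.2 hε)
  convert measure_empty (μ := (volume : Measure ℝ))
  refine Set.eq_empty_iff_forall_notMem.2 ?_
  rintro x ⟨hx, t, ht, hsubE, hle⟩
  rw [hcard] at hle
  obtain ⟨n, hn, m, hm⟩ := hc x hx t ht
  have ht0 : 0 < t := hs.trans_le ht.1
  have hmem : x + t * aseq n ∈ Set.Icc (-(N : ℝ)) (N : ℝ) := by
    refine ⟨by linarith [hx.1, mul_nonneg ht0.le (hann n)], ?_⟩
    by_contra hgt
    rw [not_le] at hgt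
    have hsub : Set.range (fun n : ℕ => x + t * aseq n) ∩ Set.Icc (-(N : ℝ)) (N : ℝ) ⊆
        Set.image (fun n : ℕ => x + t * aseq n) (Finset.range n) := by
      rintro z ⟨⟨i, rfl⟩, -, h⟩
      refine ⟨i, ?_, rfl⟩
      simp only [Finset.coe_range, Set.mem_Iio]
      by_contra hi
      have h2 := mul_le_mul_of_nonneg_left (hmono.monotone (not_lt.1 hi)) ht0.le
      simp only at h
      linarith
    have h1 := Set.ncard_le_ncard hsub ((Finset.finite_toSet _).image _)
    have h2 := Set.ncard_image_le (f := fun n : ℕ => x + t * aseq n)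
      (Finset.finite_toSet (Finset.range n))
    rw [Set.ncard_coe_finset, Finset.card_range] at h2
    omega
  have hE := hsubE ⟨⟨n, rfl⟩, hmem⟩
  exact hE.2 (Set.mem_iUnion.2 ⟨m, by rwa [Metric.mem_ball, Real.dist_eq]⟩)
end

section
/- Let d₁, d ≥ 1 be integers, let β, ζ > 0, let p ∈ (0, 1), and let α : ℕ → ℝ be a function with α(N)/log N → +∞ as N → +∞. Then there is N₀ such that for every integer N ≥ N₀ and every finite point set P ⊆ ℝ^{d₁} with at most N^ζ points, there exists a Lebesgue measurable set E_N ⊆ [−N, N]^d such that (1) |E_N ∩ (m + [0,1]^d)| ≥ p for every m = (m₁, …, m_d) ∈ ℤ^d with −N ≤ m_j < N for each j, and (2) for every linear map T : ℝ^{d₁} → ℝ^d, if T(P) ∩ [−N, N]^d contains at least α(N) points that are pairwise at distance at least N^{−β} from one another, then T(P) ∩ [−N, N]^d is not contained in E_N. -/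
open MeasureTheory Filter

lemma auer_top {V : Type*} [AddCommGroup V] [Module ℝ V] [FiniteDimensional ℝ V]
    (Q : Set V) (hQ : Q.Finite) (hs : Submodule.span ℝ Q = ⊤) :
    ∃ B : Fin (Module.finrank ℝ V) → V, (∀ i, B i ∈ Q) ∧ ∀ x ∈ Q,
      ∃ a : Fin (Module.finrank ℝ V) → ℝ, (∀ i, |a i| ≤ 1) ∧ x = ∑ i, a i • B i := by
  classical
  obtain ⟨b, hbQ, hsp, hli⟩ := exists_linearIndependent ℝ Q
  let e0 : Module.Basis b ℝ V := Module.Basis.mk hli (by simp [hsp, hs])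
  have : Fintype b := (hQ.subset hbQ).fintype
  have hcard : Fintype.card b = Module.finrank ℝ V := (Module.finrank_eq_card_basis e0).symm
  let e : Module.Basis (Fin (Module.finrank ℝ V)) ℝ V := e0.reindex (Fintype.equivFinOfCardEq hcard)
  have heQ : ∀ i, e i ∈ Q := by
    intro i
    simp only [e, e0, Module.Basis.reindex_apply, Module.Basis.mk_apply]
    exact hbQ (Subtype.mem _)
  have hfin : {v : Fin (Module.finrank ℝ V) → V | ∀ i, v i ∈ Q}.Finite := Set.Finite.pi' (fun _ => hQ)
  obtain ⟨v, hv, hmax⟩ := hfin.exists_maximalFor (fun v => |e.det v|) _ ⟨e, heQ⟩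
  have hmax' : ∀ w : Fin (Module.finrank ℝ V) → V, (∀ i, w i ∈ Q) → |e.det w| ≤ |e.det v| := by
    intro w hw
    rcases le_total (|e.det w|) (|e.det v|) with h | h
    · exact h
    · exact hmax hw h
  have h1 : 1 ≤ |e.det v| := by
    have := hmax' e heQ
    simpa [Module.Basis.det_self] using this
  have hu : IsUnit (e.det v) := by
    rw [isUnit_iff_ne_zero]; intro h; rw [h] at h1; norm_num at h1
  obtain ⟨l, sp⟩ := (Module.Basis.is_basis_iff_det e).2 hu
  refine ⟨v, hv, fun x hx => ⟨(Module.Basis.mk l sp.ge).repr x, ?_, ?_⟩⟩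
  · intro i
    have h := congrArg (fun g => g x) (e.det_smul_mk_coord_eq_det_update l sp.ge i)
    simp only [LinearMap.smul_apply, Module.Basis.coord_apply, smul_eq_mul, MultilinearMap.toLinearMap_apply, AlternatingMap.coe_multilinearMap] at h
    have h2 := hmax' (Function.update v i x) (by
      intro j
      by_cases hj : j = i
      · subst hj; simpa using hx
      · simpa [hj] using hv j)
    rw [← h, abs_mul] at h2
    by_contra! h3
    nlinarith
  · have := (Module.Basis.mk l sp.ge).sum_repr x
    simpa using this.symm

lemma auer {V : Type*} [AddCommGroup V] [Module ℝ V] [FiniteDimensional ℝ V]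
    (Q : Set V) (hQ : Q.Finite) (hne : Q.Nonempty) (n : ℕ) (hn : Module.finrank ℝ V ≤ n) :
    ∃ B : Fin n → V, (∀ i, B i ∈ Q) ∧ ∀ x ∈ Q,
      ∃ a : Fin n → ℝ, (∀ i, |a i| ≤ 1) ∧ x = ∑ i, a i • B i := by
  let W := Submodule.span ℝ Q
  obtain ⟨B, hB, h⟩ := auer_top (V := W) ((Subtype.val : W → V) ⁻¹' Q)
    (hQ.preimage Subtype.val_injective.injOn) Submodule.span_span_coe_preimage
  have hle : Module.finrank ℝ W ≤ n := (Submodule.finrank_le W).trans hn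
  obtain ⟨q, hq⟩ := hne
  generalize Module.finrank ℝ W = k at *
  obtain ⟨j, rfl⟩ := Nat.exists_eq_add_of_le hle
  refine ⟨Fin.append (fun i => (B i : V)) (fun _ => q), ?_, ?_⟩
  · intro i
    refine Fin.addCases (fun i => ?_) (fun i => ?_) i
    · rw [Fin.append_left]; exact hB i
    · rw [Fin.append_right]; exact hq
  · intro x hx
    obtain ⟨a, ha, hxa⟩ := h ⟨x, Submodule.subset_span hx⟩ hx
    refine ⟨Fin.append a (fun _ => 0), ?_, ?_⟩
    · intro i
      refine Fin.addCases (fun i => ?_) (fun i => ?_) i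
      · rw [Fin.append_left]; exact ha i
      · rw [Fin.append_right]; simp
    · rw [Fin.sum_univ_add]
      have := congrArg (Subtype.val) hxa
      simpa using this

lemma comb {ι κ 𝓓 : Type*} [Fintype κ] [Nonempty κ] (Ds : Finset 𝓓)
    (F : 𝓓 → Finset (ι × κ)) (m : ℕ)
    (hF : ∀ D ∈ Ds, (m : ℝ) * Fintype.card κ < (F D).card + Fintype.card κ)
    (h : Ds.card * (Fintype.card κ - 1) ^ m < (Fintype.card κ) ^ m) :
    ∃ f : ι → κ, ∀ D ∈ Ds, ∃ c ∈ F D, f c.1 = c.2 := by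
  classical
  let Bl : Finset ι := Ds.biUnion (fun D => (F D).image Prod.fst)
  have key : ∀ D ∈ Ds, ((Finset.univ : Finset (Bl → κ)).filter
      (fun f => ∀ b : Bl, ∀ k, (b.1, k) ∈ F D → f b ≠ k)).card * (Fintype.card κ) ^ m
        ≤ (Fintype.card κ - 1) ^ m * (Fintype.card κ) ^ Bl.card := by
    intro D hD
    have hm : m ≤ ((F D).image Prod.fst).card := by
      have h1 : (F D).card ≤ ((F D).image Prod.fst).card * Fintype.card κ := by
        rw [← Finset.card_univ, ← Finset.card_product]
        apply Finset.card_le_card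
        intro c hc
        simp only [Finset.mem_product, Finset.mem_image, Finset.mem_univ, and_true]
        exact ⟨c, hc, rfl⟩
      have h2 := hF D hD
      have h3 : m * Fintype.card κ < (((F D).image Prod.fst).card + 1) * Fintype.card κ := by
        have : m * Fintype.card κ < (F D).card + Fintype.card κ := by exact_mod_cast h2
        linarith
      have := lt_of_mul_lt_mul_right h3 (Nat.zero_le _)
      omega
    obtain ⟨H, hH, hHc⟩ := Finset.exists_subset_card_eq hm
    have hg : ∀ b : ι, ∃ k, b ∈ H → (b, k) ∈ F D := by
      intro b
      by_cases hb : b ∈ H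
      · obtain ⟨c, hc, rfl⟩ := Finset.mem_image.1 (hH hb)
        exact ⟨c.2, fun _ => hc⟩
      · exact ⟨Classical.arbitrary κ, fun h => absurd h hb⟩
    choose g hg using hg
    have hHB : H ⊆ Bl := fun b hb => Finset.mem_biUnion.2 ⟨D, hD, hH hb⟩
    have hsub : ((Finset.univ : Finset (Bl → κ)).filter
      (fun f => ∀ b : Bl, ∀ k, (b.1, k) ∈ F D → f b ≠ k)) ⊆
        Fintype.piFinset (fun b : Bl => if b.1 ∈ H then Finset.univ.erase (g b.1) else Finset.univ) := by
      intro f hf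
      rw [Finset.mem_filter] at hf
      rw [Fintype.mem_piFinset]
      intro b
      split_ifs with hb
      · simpa using hf.2 b _ (hg _ hb)
      · simp
    have hc := Finset.card_le_card hsub
    have hcard : (Fintype.piFinset (fun b : Bl => if b.1 ∈ H then Finset.univ.erase (g b.1) else Finset.univ)).card
       = (Fintype.card κ - 1) ^ m * (Fintype.card κ) ^ (Bl.card - m) := by
      rw [Fintype.card_piFinset]
      have : ∀ b : Bl, (if b.1 ∈ H then Finset.univ.erase (g b.1) else Finset.univ).card
        = (fun b => if b ∈ H then Fintype.card κ - 1 else Fintype.card κ) b.1 := by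
        intro b
        dsimp only
        split_ifs <;> simp [Finset.card_erase_of_mem]
      rw [Finset.prod_congr rfl (fun b _ => this b), Finset.prod_coe_sort Bl (fun b => if b ∈ H then Fintype.card κ - 1 else Fintype.card κ), Finset.prod_ite]
      simp only [Finset.prod_const]
      have e1 : Bl.filter (fun b => b ∈ H) = H := by
        ext b; simp; exact fun h => hHB h
      have e2 : Bl.filter (fun b => b ∉ H) = Bl \ H := by
        ext b; simp
      rw [e1, e2, Finset.card_sdiff_of_subset hHB, hHc]
    rw [hcard] at hc
    calc _ ≤ (Fintype.card κ - 1) ^ m * (Fintype.card κ) ^ (Bl.card - m) * (Fintype.card κ) ^ m := Nat.mul_le_mul_right _ hc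
      _ = _ := by
        rw [mul_assoc, ← pow_add, Nat.sub_add_cancel]
        rw [← hHc]; exact Finset.card_le_card hHB
  by_contra! hcon
  have hcover : (Finset.univ : Finset (Bl → κ)) ⊆ Ds.biUnion (fun D => (Finset.univ : Finset (Bl → κ)).filter
      (fun f => ∀ b : Bl, ∀ k, (b.1, k) ∈ F D → f b ≠ k)) := by
    intro f _
    obtain ⟨D, hD, hf⟩ := hcon (fun b => if hb : b ∈ Bl then f ⟨b, hb⟩ else Classical.arbitrary κ)
    rw [Finset.mem_biUnion]
    refine ⟨D, hD, ?_⟩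
    rw [Finset.mem_filter]
    refine ⟨Finset.mem_univ _, ?_⟩
    intro b k hbk
    have := hf (b.1, k) hbk
    simpa using this
  have h1 := (Finset.card_le_card hcover).trans Finset.card_biUnion_le
  have h2 : Fintype.card κ ^ Bl.card * Fintype.card κ ^ m ≤
      Ds.card * ((Fintype.card κ - 1) ^ m * (Fintype.card κ) ^ Bl.card) := by
    have e : (Finset.univ : Finset (Bl → κ)).card = Fintype.card κ ^ Bl.card := by simp
    rw [e] at h1
    refine (Nat.mul_le_mul_right _ h1).trans ?_
    rw [Finset.sum_mul]
    exact (Finset.sum_le_card_nsmul _ _ _ key).trans (by simp)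
  have hpos : 0 < Fintype.card κ ^ Bl.card := pow_pos Fintype.card_pos _
  nlinarith

def fcube {d s : ℕ} (Λ σ : ℝ) (c : (Fin d → ℤ) × (Fin d → Fin s)) : Set (EuclideanSpace ℝ (Fin d)) :=
  {x | ∀ j, (s : ℝ) * (c.1 j : ℝ) + ((c.2 j : ℕ) : ℝ) + σ ≤ Λ * x j ∧
    Λ * x j ≤ (s : ℝ) * (c.1 j : ℝ) + ((c.2 j : ℕ) : ℝ) + 1 - σ}

lemma fcube_unique {d s : ℕ} {Λ σ : ℝ} (hσ : 0 < σ) {c c' : (Fin d → ℤ) × (Fin d → Fin s)}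
    {x : EuclideanSpace ℝ (Fin d)} (h : x ∈ fcube Λ 0 c) (h' : x ∈ fcube Λ σ c') : c = c' := by
  have key : ∀ j, c.1 j = c'.1 j ∧ c.2 j = c'.2 j := by
    intro j
    have h1 := h j
    have h2 := h' j
    have e : (s : ℤ) * c.1 j + ((c.2 j : ℕ) : ℤ) = (s : ℤ) * c'.1 j + ((c'.2 j : ℕ) : ℤ) := by
      apply le_antisymm
      · apply Int.le_of_lt_add_one
        have : (s : ℝ) * (c.1 j : ℝ) + ((c.2 j : ℕ) : ℝ) < (s : ℝ) * (c'.1 j : ℝ) + ((c'.2 j : ℕ) : ℝ) + 1 := by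
          linarith
        exact_mod_cast this
      · apply Int.le_of_lt_add_one
        have : (s : ℝ) * (c'.1 j : ℝ) + ((c'.2 j : ℕ) : ℝ) < (s : ℝ) * (c.1 j : ℝ) + ((c.2 j : ℕ) : ℝ) + 1 := by
          linarith
        exact_mod_cast this
    have l1 := (c.2 j).2
    have l2 := (c'.2 j).2
    have e1 : c.1 j = c'.1 j := by
      by_contra hne
      rcases lt_or_gt_of_ne hne with h | h
      · have : (s : ℤ) * (c.1 j + 1) ≤ s * c'.1 j := mul_le_mul_of_nonneg_left (by omega) (by positivity)
        rw [mul_add] at this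
        omega
      · have : (s : ℤ) * (c'.1 j + 1) ≤ s * c.1 j := mul_le_mul_of_nonneg_left (by omega) (by positivity)
        rw [mul_add] at this
        omega
    refine ⟨e1, ?_⟩
    rw [e1] at e
    apply Fin.ext
    omega
  exact Prod.ext (funext fun j => (key j).1) (funext fun j => (key j).2)

lemma fcube_mono {d s : ℕ} {Λ σ τ : ℝ} (h : τ ≤ σ) (c : (Fin d → ℤ) × (Fin d → Fin s)) :
    fcube Λ σ c ⊆ fcube Λ τ c := by
  intro x hx j
  have := hx j
  constructor <;> linarith

lemma fcube_eq {d s : ℕ} {Λ σ : ℝ} (hΛ : 0 < Λ) (c : (Fin d → ℤ) × (Fin d → Fin s)) :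
    fcube Λ σ c = (WithLp.ofLp : EuclideanSpace ℝ (Fin d) → (Fin d → ℝ)) ⁻¹'
      Set.Icc (fun j => ((s : ℝ) * (c.1 j : ℝ) + ((c.2 j : ℕ) : ℝ) + σ) / Λ)
        (fun j => ((s : ℝ) * (c.1 j : ℝ) + ((c.2 j : ℕ) : ℝ) + 1 - σ) / Λ) := by
  ext x
  simp only [fcube, Set.mem_ofPred_eq, Set.mem_preimage, Set.mem_Icc, Pi.le_def, ← forall_and,
    div_le_iff₀ hΛ, le_div_iff₀ hΛ, mul_comm Λ]

lemma fcube_meas {d s : ℕ} {Λ σ : ℝ} (hΛ : 0 < Λ) (c : (Fin d → ℤ) × (Fin d → Fin s)) :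
    MeasurableSet (fcube Λ σ c) := by
  rw [fcube_eq hΛ]
  exact (PiLp.volume_preserving_ofLp (Fin d)).measurable measurableSet_Icc

lemma fcube_vol {d s : ℕ} {Λ σ : ℝ} (hΛ : 0 < Λ) (hσ : σ ≤ 1 / 2) (c : (Fin d → ℤ) × (Fin d → Fin s)) :
    volume (fcube Λ σ c) = ENNReal.ofReal (((1 - 2 * σ) / Λ) ^ d) := by
  rw [fcube_eq hΛ, (PiLp.volume_preserving_ofLp (Fin d)).measure_preimage measurableSet_Icc.nullMeasurableSet,
    Real.volume_Icc_pi]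
  have : ∀ j : Fin d, ((s : ℝ) * (c.1 j : ℝ) + ((c.2 j : ℕ) : ℝ) + 1 - σ) / Λ -
     ((s : ℝ) * (c.1 j : ℝ) + ((c.2 j : ℕ) : ℝ) + σ) / Λ = (1 - 2 * σ) / Λ := by
    intro j; ring
  simp only [this, Finset.prod_const, Finset.card_univ, Fintype.card_fin]
  rw [ENNReal.ofReal_pow]
  exact div_nonneg (by linarith) hΛ.le

open Classical in
lemma vol_bound {d s L N : ℕ} {σ : ℝ} (hs : 1 ≤ s) (hL : 1 ≤ L) (hσ0 : 0 < σ) (hσ : σ ≤ 1 / 2)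
    (f : (Fin d → ℤ) → (Fin d → Fin s)) (m : Fin d → ℤ)
    (hm : ∀ j : Fin d, -(N : ℤ) ≤ m j ∧ m j < (N : ℤ)) :
    ENNReal.ofReal ((1 - 1 / (s : ℝ) ^ d) * (1 - 2 * σ) ^ d) ≤
      volume ((⋃ c ∈ ((Fintype.piFinset fun _ : Fin d => Finset.Ico (-((N : ℤ) * L)) (N * L)) ×ˢ
          (Finset.univ : Finset (Fin d → Fin s))).filter (fun c => f c.1 ≠ c.2),
          fcube ((s : ℝ) * L) σ c) ∩ {x : EuclideanSpace ℝ (Fin d) |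
                ∀ i : Fin d, (m i : ℝ) ≤ x i ∧ x i ≤ (m i : ℝ) + 1}) := by
  have hs' : (0 : ℝ) < s := by exact_mod_cast hs
  have hL' : (0 : ℝ) < L := by exact_mod_cast hL
  have hΛ : (0 : ℝ) < (s : ℝ) * L := by positivity
  let K := ((Fintype.piFinset fun j : Fin d => Finset.Ico (m j * L) (m j * L + L)) ×ˢ
          (Finset.univ : Finset (Fin d → Fin s))).filter (fun c => f c.1 ≠ c.2)
  have hKc : K.card = L ^ d * (s ^ d - 1) := by
    simp only [K]
    rw [Finset.card_filter, Finset.sum_product]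
    have : ∀ b : Fin d → ℤ, (∑ t : Fin d → Fin s, if f b ≠ t then 1 else 0) = s ^ d - 1 := by
      intro b
      rw [← Finset.card_filter]
      have : (Finset.univ.filter fun t => f b ≠ t) = Finset.univ.erase (f b) := by
        ext t; simp [eq_comm]
      rw [this, Finset.card_erase_of_mem (Finset.mem_univ _)]
      simp
    rw [Finset.sum_congr rfl (fun b _ => this b)]
    simp
  have hsub : (⋃ c ∈ K, fcube ((s : ℝ) * L) σ c) ⊆ ((⋃ c ∈ ((Fintype.piFinset fun _ : Fin d => Finset.Ico (-((N : ℤ) * L)) (N * L)) ×ˢ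
          (Finset.univ : Finset (Fin d → Fin s))).filter (fun c => f c.1 ≠ c.2),
          fcube ((s : ℝ) * L) σ c) ∩ {x : EuclideanSpace ℝ (Fin d) |
                ∀ i : Fin d, (m i : ℝ) ≤ x i ∧ x i ≤ (m i : ℝ) + 1}) := by
    intro x hx
    simp only [Set.mem_iUnion] at hx
    obtain ⟨c, hc, hx⟩ := hx
    simp only [K, Finset.mem_filter, Finset.mem_product, Fintype.mem_piFinset, Finset.mem_Ico,
      Finset.mem_univ, and_true] at hc
    refine ⟨?_, ?_⟩
    · simp only [Set.mem_iUnion]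
      refine ⟨c, ?_, hx⟩
      simp only [Finset.mem_filter, Finset.mem_product, Fintype.mem_piFinset, Finset.mem_Ico,
        Finset.mem_univ, and_true]
      refine ⟨fun j => ?_, hc.2⟩
      have h1 := hc.1 j
      have h2 := hm j
      have hLz : (1 : ℤ) ≤ L := by exact_mod_cast hL
      constructor
      · nlinarith
      · nlinarith
    · intro i
      have h1 := hc.1 i
      have h2 := hx i
      have h3 := (c.2 i).2
      have h3' : (((c.2 i : ℕ) : ℝ)) + 1 ≤ s := by exact_mod_cast h3
      have h4 : (m i : ℝ) * L ≤ c.1 i := by exact_mod_cast h1.1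
      have h5 : (c.1 i : ℝ) + 1 ≤ m i * L + L := by exact_mod_cast h1.2
      have h6 : (0 : ℝ) ≤ ((c.2 i : ℕ) : ℝ) := by positivity
      have h7 := mul_le_mul_of_nonneg_left h4 hs'.le
      have h8 := mul_le_mul_of_nonneg_left h5 hs'.le
      constructor
      · refine le_of_mul_le_mul_left ?_ hΛ
        nlinarith
      · refine le_of_mul_le_mul_left ?_ hΛ
        nlinarith
  refine le_trans ?_ (measure_mono hsub)
  rw [measure_biUnion_finset]
  · rw [Finset.sum_congr rfl (fun c _ => fcube_vol hΛ hσ c), Finset.sum_const, hKc, nsmul_eq_mul,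
      ← ENNReal.ofReal_natCast, ← ENNReal.ofReal_mul (by positivity)]
    apply le_of_eq
    congr 1
    rw [Nat.cast_mul, Nat.cast_sub (Nat.one_le_pow _ _ hs)]
    push_cast
    rw [div_pow, mul_pow]
    field_simp
  · intro c _ c' _ hne
    rw [Function.onFun, Set.disjoint_left]
    intro x hx hx'
    exact hne (fcube_unique hσ0 (fcube_mono hσ0.le _ hx) hx')
  · intro c _
    exact fcube_meas hΛ c

lemma count_bound {N r A D : ℕ} {a : ℝ} (hN : 2 ≤ N) (hr : 1 ≤ r)
    (ha : (A : ℝ) * r ^ 2 * Real.log N < a) (hD : D ≤ N ^ A) :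
    D * (r - 1) ^ ⌈a / r⌉₊ < r ^ ⌈a / r⌉₊ := by
  have hr' : (0 : ℝ) < r := by exact_mod_cast hr
  have hN' : (0 : ℝ) < N := by positivity
  have h : (D : ℝ) * ((r : ℝ) - 1) ^ ⌈a / r⌉₊ < (r : ℝ) ^ ⌈a / r⌉₊ := by
    set m := ⌈a / r⌉₊
    have hm : a / r ≤ m := Nat.le_ceil _
    have h1 : (r : ℝ) - 1 ≤ r * Real.exp (-(1 / r)) := by
      have := Real.add_one_le_exp (-(1 / (r : ℝ)))
      have := mul_le_mul_of_nonneg_left this hr'.le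
      refine le_trans (le_of_eq ?_) this
      field_simp
      ring
    have h0 : (0 : ℝ) ≤ r - 1 := by
      have : (1 : ℝ) ≤ r := by exact_mod_cast hr
      linarith
    have h2 : ((r : ℝ) - 1) ^ m ≤ r ^ m * Real.exp (-(m / r)) := by
      refine (pow_le_pow_left₀ h0 h1 m).trans (le_of_eq ?_)
      rw [mul_pow, ← Real.exp_nat_mul]
      congr 2
      ring
    have h3 : (D : ℝ) ≤ Real.exp (A * Real.log N) := by
      rw [Real.exp_nat_mul, Real.exp_log hN']
      exact_mod_cast hD
    have h4 : (D : ℝ) * Real.exp (-(m / r)) < 1 := by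
      refine (mul_le_mul_of_nonneg_right h3 (Real.exp_pos _).le).trans_lt ?_
      rw [← Real.exp_add, Real.exp_lt_one_iff]
      have : a / r / r ≤ m / r := by gcongr
      have h5 : A * Real.log N < a / r / r := by
        rw [div_div, lt_div_iff₀ (by positivity)]
        linarith
      linarith
    calc (D : ℝ) * ((r : ℝ) - 1) ^ m ≤ D * (r ^ m * Real.exp (-(m / r))) := by gcongr
      _ = r ^ m * (D * Real.exp (-(m / r))) := by ring
      _ < r ^ m * 1 := by gcongr
      _ = _ := mul_one _
  have : ((D * (r - 1) ^ ⌈a / r⌉₊ : ℕ) : ℝ) < ((r ^ ⌈a / r⌉₊ : ℕ) : ℝ) := by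
    rw [Nat.cast_mul, Nat.cast_pow, Nat.cast_pow, Nat.cast_sub hr]
    simpa using h
  exact_mod_cast this

/-- The cells approximately hit by the images of `P` under the rounded data `D = (B, v)`. -/
def hitCells {d₁ d s : ℕ} (P : Set (EuclideanSpace ℝ (Fin d₁))) (Λ M σ : ℝ)
    (Z : Finset ((Fin d → ℤ) × (Fin d → Fin s)))
    (D : (Fin d₁ → EuclideanSpace ℝ (Fin d₁)) × (Fin d₁ → Fin d → ℤ)) :
    Set ((Fin d → ℤ) × (Fin d → Fin s)) :=
  {c | c ∈ Z ∧ ∃ x ∈ P, ∃ a : Fin d₁ → ℝ, (∀ i, |a i| ≤ 1) ∧ x = ∑ i, a i • D.1 i ∧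
    (WithLp.toLp 2 (fun j => ∑ i, a i * ((D.2 i j : ℝ) / M)) : EuclideanSpace ℝ (Fin d)) ∈
      fcube Λ (σ / 2) c}

lemma fcube_box {d s L N : ℕ} (hs : 1 ≤ s) (hL : 1 ≤ L)
    {c : (Fin d → ℤ) × (Fin d → Fin s)} {x : EuclideanSpace ℝ (Fin d)}
    (hc : ∀ j, -((N : ℤ) * L) ≤ c.1 j ∧ c.1 j < N * L) (hx : x ∈ fcube ((s : ℝ) * L) 0 c) (i : Fin d) :
    |x i| ≤ (N : ℝ) := by
  have hs' : (0 : ℝ) < s := by exact_mod_cast hs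
  have hL' : (0 : ℝ) < L := by exact_mod_cast hL
  have hΛ : (0 : ℝ) < (s : ℝ) * L := by positivity
  have h1 := hc i
  have h2 := hx i
  have h3 := (c.2 i).2
  have h3' : (((c.2 i : ℕ) : ℝ)) + 1 ≤ s := by exact_mod_cast h3
  have h4 : -((N : ℝ) * L) ≤ c.1 i := by exact_mod_cast h1.1
  have h5 : (c.1 i : ℝ) + 1 ≤ N * L := by exact_mod_cast h1.2
  have h6 : (0 : ℝ) ≤ ((c.2 i : ℕ) : ℝ) := by positivity
  have h7 := mul_le_mul_of_nonneg_left h4 hs'.le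
  have h8 := mul_le_mul_of_nonneg_left h5 hs'.le
  rw [abs_le]
  constructor
  · refine le_of_mul_le_mul_left ?_ hΛ
    nlinarith
  · refine le_of_mul_le_mul_left ?_ hΛ
    nlinarith

lemma fcube_dist {d s L : ℕ} {σ : ℝ} (hs : 1 ≤ s) (hL : 1 ≤ L) (hσ : 0 ≤ σ)
    {c : (Fin d → ℤ) × (Fin d → Fin s)} {x y : EuclideanSpace ℝ (Fin d)}
    (hx : x ∈ fcube ((s : ℝ) * L) σ c) (hy : y ∈ fcube ((s : ℝ) * L) σ c) :
    dist x y ≤ d / L := by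
  have hs' : (1 : ℝ) ≤ s := by exact_mod_cast hs
  have hL' : (0 : ℝ) < L := by exact_mod_cast hL
  have h1 : ∀ i, |x i - y i| ≤ 1 / L := by
    intro i
    have h2 := hx i
    have h3 := hy i
    rw [le_div_iff₀ hL']
    have h4 : |(s * L : ℝ) * (x i - y i)| ≤ 1 := by
      rw [abs_le]; constructor <;> nlinarith
    rw [abs_mul, abs_of_pos (by positivity)] at h4
    have : 0 ≤ L * |x i - y i| := by positivity
    nlinarith
  rw [EuclideanSpace.dist_eq]
  have h0 : (0 : ℝ) ≤ d / L := by positivity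
  apply Real.sqrt_le_iff.2 ⟨h0, ?_⟩
  calc ∑ i, dist (x i) (y i) ^ 2 ≤ ∑ i : Fin d, (1 / L : ℝ) ^ 2 := by
        apply Finset.sum_le_sum
        intro i _
        rw [Real.dist_eq]
        exact pow_le_pow_left₀ (abs_nonneg _) (h1 i) 2
    _ = d * (1 / L : ℝ) ^ 2 := by simp
    _ ≤ (d / L : ℝ) ^ 2 := by
        rw [div_pow, div_pow, one_pow, mul_one_div]
        gcongr
        have : d ≤ d ^ 2 := Nat.le_self_pow (by norm_num) d
        exact_mod_cast this

open Classical in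
lemma core {d₁ d s L R N : ℕ} {σ ρ A : ℝ} (hs : 1 ≤ s) (hL : 1 ≤ L) (hR : 1 ≤ R)
    (hσ0 : 0 < σ) (hRσ : (d₁ : ℝ) / R ≤ σ / 2) (hρ : (d : ℝ) / L < ρ) (hA : 0 < A)
    (P : Set (EuclideanSpace ℝ (Fin d₁))) (hP : P.Finite)
    (f : (Fin d → ℤ) → (Fin d → Fin s))
    (Z : Finset ((Fin d → ℤ) × (Fin d → Fin s)))
    (hZ : ∀ c, c ∈ Z ↔ ∀ j, -((N : ℤ) * L) ≤ c.1 j ∧ c.1 j < N * L)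
    (hf : ∀ D : (Fin d₁ → EuclideanSpace ℝ (Fin d₁)) × (Fin d₁ → Fin d → ℤ),
      (∀ i, D.1 i ∈ P) → (∀ i j, -((N : ℤ) * (s * L * R)) ≤ D.2 i j ∧ D.2 i j ≤ N * (s * L * R)) →
      A ≤ ((hitCells P ((s : ℝ) * L) ((s : ℝ) * L * R) σ Z D).ncard : ℝ) →
      ∃ c ∈ hitCells P ((s : ℝ) * L) ((s : ℝ) * L * R) σ Z D, f c.1 = c.2)
    (T : EuclideanSpace ℝ (Fin d₁) →ₗ[ℝ] EuclideanSpace ℝ (Fin d))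
    (S : Set (EuclideanSpace ℝ (Fin d)))
    (hS : S ⊆ (T '' P) ∩ {x : EuclideanSpace ℝ (Fin d) | ∀ i : Fin d, |x i| ≤ (N : ℝ)})
    (hSA : A ≤ (S.ncard : ℝ)) (hSp : S.Pairwise (fun u v => ρ ≤ dist u v))
    (hE : (T '' P) ∩ {x : EuclideanSpace ℝ (Fin d) | ∀ i : Fin d, |x i| ≤ (N : ℝ)} ⊆
      ⋃ c ∈ Z.filter (fun c => f c.1 ≠ c.2), fcube ((s : ℝ) * L) σ c) : False := by
  have hs' : (0 : ℝ) < s := by exact_mod_cast hs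
  have hL' : (0 : ℝ) < L := by exact_mod_cast hL
  have hR' : (0 : ℝ) < R := by exact_mod_cast hR
  have hΛ : (0 : ℝ) < (s : ℝ) * L := by positivity
  have hM : (0 : ℝ) < (s : ℝ) * L * R := by positivity
  have hSne : S.Nonempty := by
    rw [Set.nonempty_iff_ne_empty]
    rintro rfl
    simp at hSA
    linarith
  let Q : Set (EuclideanSpace ℝ (Fin d₁)) := {x ∈ P | ∀ i, |T x i| ≤ (N : ℝ)}
  have hQne : Q.Nonempty := by
    obtain ⟨y, hy⟩ := hSne
    obtain ⟨⟨x, hx, rfl⟩, hb⟩ := hS hy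
    exact ⟨x, hx, hb⟩
  obtain ⟨B, hB, hBa⟩ := auer Q (hP.subset fun x hx => hx.1) hQne d₁ (by simp)
  let v : Fin d₁ → Fin d → ℤ := fun i j => ⌊(s * L * R : ℝ) * T (B i) j⌋
  have hv1 : ∀ i j, |T (B i) j - (v i j : ℝ) / (s * L * R)| ≤ 1 / (s * L * R) := by
    intro i j
    have h1 : (v i j : ℝ) ≤ (s * L * R : ℝ) * T (B i) j := Int.floor_le _
    have h2 : (s * L * R : ℝ) * T (B i) j < v i j + 1 := Int.lt_floor_add_one _
    rw [le_div_iff₀ hM]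
    have e : |T (B i) j - (v i j : ℝ) / (s * L * R)| * (s * L * R) =
      |(T (B i) j - (v i j : ℝ) / (s * L * R)) * (s * L * R)| := by
      rw [abs_mul, abs_of_pos hM]
    rw [e, sub_mul, div_mul_cancel₀ _ hM.ne', abs_le]
    constructor <;> linarith
  have happ : ∀ a : Fin d₁ → ℝ, (∀ i, |a i| ≤ 1) → ∀ j,
      |(s * L : ℝ) * T (∑ i, a i • B i) j - (s * L : ℝ) * ∑ i, a i * ((v i j : ℝ) / (s * L * R))| ≤ σ / 2 := by
    intro a ha j
    have e : (s * L : ℝ) * T (∑ i, a i • B i) j - (s * L : ℝ) * ∑ i, a i * ((v i j : ℝ) / (s * L * R)) =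
      (s * L : ℝ) * ∑ i, a i * (T (B i) j - (v i j : ℝ) / (s * L * R)) := by
      rw [map_sum]
      simp only [map_smul, WithLp.ofLp_sum, Finset.sum_apply, PiLp.smul_apply, smul_eq_mul, mul_sub,
        Finset.sum_sub_distrib]
    rw [e, abs_mul, abs_of_pos hΛ]
    have h1 : |∑ i, a i * (T (B i) j - (v i j : ℝ) / (s * L * R))| ≤ d₁ * (1 / (s * L * R) : ℝ) := by
      refine (Finset.abs_sum_le_sum_abs _ _).trans ?_
      calc _ ≤ ∑ i : Fin d₁, (1 / (s * L * R) : ℝ) := by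
            apply Finset.sum_le_sum
            intro i _
            rw [abs_mul]
            have := mul_le_mul (ha i) (hv1 i j) (abs_nonneg _) zero_le_one
            linarith
        _ = _ := by simp
    refine (mul_le_mul_of_nonneg_left h1 hΛ.le).trans (le_trans (le_of_eq ?_) hRσ)
    field_simp
  -- every point of `T(P)` in the box is in a unique cell which is hit
  have hcell : ∀ y ∈ S, ∃ c, y ∈ fcube ((s : ℝ) * L) σ c ∧
      c ∈ hitCells P ((s : ℝ) * L) ((s : ℝ) * L * R) σ Z (B, v) := by
    intro y hy
    have hyE := hE (hS hy)
    simp only [Set.mem_iUnion, Finset.mem_filter] at hyE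
    obtain ⟨c, ⟨hcZ, hcf⟩, hyc⟩ := hyE
    obtain ⟨⟨x, hx, rfl⟩, hb⟩ := hS hy
    refine ⟨c, hyc, hcZ, x, hx, ?_⟩
    obtain ⟨a, ha, hxa⟩ := hBa x ⟨hx, hb⟩
    refine ⟨a, ha, hxa, ?_⟩
    intro j
    have h1 := abs_le.1 (happ a ha j)
    have h2 := hyc j
    rw [← hxa] at h1
    constructor
    · show _ ≤ _ * ∑ i, a i * ((v i j : ℝ) / (s * L * R))
      linarith [h1.1, h1.2, h2.1, h2.2]
    · show _ * ∑ i, a i * ((v i j : ℝ) / (s * L * R)) ≤ _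
      linarith [h1.1, h1.2, h2.1, h2.2]
  have : Nonempty ((Fin d → ℤ) × (Fin d → Fin s)) := ⟨(fun _ => 0, fun _ => ⟨0, hs⟩)⟩
  choose! g hg1 hg2 using hcell
  have hinj : Set.InjOn g S := by
    intro y hy z hz hyz
    by_contra hne
    have h1 := hSp hy hz hne
    have h2 := hg1 z hz
    rw [← hyz] at h2
    have := fcube_dist hs hL hσ0.le (hg1 y hy) h2
    linarith
  have hfinH : (hitCells P ((s : ℝ) * L) ((s : ℝ) * L * R) σ Z (B, v)).Finite :=
    Z.finite_toSet.subset fun c hc => hc.1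
  have hle : S.ncard ≤ (hitCells P ((s : ℝ) * L) ((s : ℝ) * L * R) σ Z (B, v)).ncard :=
    Set.ncard_le_ncard_of_injOn g hg2 hinj hfinH
  obtain ⟨c, hc, hfc⟩ := hf (B, v) (fun i => (hB i).1) (by
      intro i j
      have h1 := abs_le.1 ((hB i).2 j)
      constructor
      · apply Int.le_floor.2
        push_cast
        nlinarith [h1.1]
      · have : (v i j : ℝ) ≤ N * (s * L * R) := by
          refine (Int.floor_le _).trans ?_
          nlinarith [h1.2]
        exact_mod_cast this) (hSA.trans (by exact_mod_cast hle))
  obtain ⟨hcZ, x, hx, a, ha, hxa, hxc⟩ := hc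
  have hTx : T x ∈ fcube ((s : ℝ) * L) 0 c := by
    intro j
    have h1 := abs_le.1 (happ a ha j)
    have h2 := hxc j
    dsimp only at h2 hxa
    rw [← hxa] at h1
    constructor <;> linarith [h1.1, h1.2, h2.1, h2.2]
  have hTE := hE ⟨⟨x, hx, rfl⟩, fun i => fcube_box hs hL ((hZ c).1 hcZ) hTx i⟩
  simp only [Set.mem_iUnion, Finset.mem_filter] at hTE
  obtain ⟨c', ⟨_, hc'f⟩, hc'⟩ := hTE
  have := fcube_unique hσ0 hTx hc'
  subst this
  exact hc'f hfc

/-- **The finitary higher-dimensional theorem.**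
For all `d₁, d ≥ 1`, `β, ζ > 0`, `p ∈ (0,1)` and `α` with `α N / log N → ∞`, there is `N₀`
such that for every `N ≥ N₀` and every finite `P ⊆ ℝ^{d₁}` with at most `N^ζ` points there
is a measurable `E_N ⊆ [-N, N]^d` of measure ≥ `p` in every integer unit cube inside
`[-N, N]^d`, such that for every linear `T : ℝ^{d₁} → ℝ^d`, if `T(P) ∩ [-N, N]^d` contains
at least `α N` points with pairwise separation `≥ N^{-β}`, then `T(P) ∩ [-N, N]^d ⊄ E_N`. -/
theorem finitary_highdim_avoidance
    (d₁ d : ℕ) (hd₁ : 1 ≤ d₁) (hd : 1 ≤ d)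
    (β ζ : ℝ) (hβ : 0 < β) (hζ : 0 < ζ)
    (p : ℝ) (hp0 : 0 < p) (hp1 : p < 1)
    (α : ℕ → ℝ)
    (hα : Tendsto (fun N : ℕ => α N / Real.log (N : ℝ)) atTop atTop) :
    ∃ N₀ : ℕ, ∀ N : ℕ, N₀ ≤ N →
      ∀ P : Set (EuclideanSpace ℝ (Fin d₁)), P.Finite → (P.ncard : ℝ) ≤ (N : ℝ) ^ ζ →
        ∃ E : Set (EuclideanSpace ℝ (Fin d)), MeasurableSet E ∧
          E ⊆ {x : EuclideanSpace ℝ (Fin d) | ∀ i : Fin d, |x i| ≤ (N : ℝ)} ∧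
          (∀ m : Fin d → ℤ, (∀ j : Fin d, -(N : ℤ) ≤ m j ∧ m j < (N : ℤ)) →
            ENNReal.ofReal p ≤
              volume (E ∩ {x : EuclideanSpace ℝ (Fin d) |
                ∀ i : Fin d, (m i : ℝ) ≤ x i ∧ x i ≤ (m i : ℝ) + 1})) ∧
          (∀ T : EuclideanSpace ℝ (Fin d₁) →ₗ[ℝ] EuclideanSpace ℝ (Fin d),
            (∃ S : Set (EuclideanSpace ℝ (Fin d)),
              S ⊆ (T '' P) ∩ {x : EuclideanSpace ℝ (Fin d) | ∀ i : Fin d, |x i| ≤ (N : ℝ)} ∧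
              S.Finite ∧ α N ≤ (S.ncard : ℝ) ∧
              S.Pairwise (fun u v => (N : ℝ) ^ (-β) ≤ dist u v)) →
            ¬ ((T '' P) ∩ {x : EuclideanSpace ℝ (Fin d) | ∀ i : Fin d, |x i| ≤ (N : ℝ)} ⊆ E)) := by
  classical
  -- constants
  set ε : ℝ := (1 - p) / 2 with hε
  have hε0 : 0 < ε := by rw [hε]; linarith
  have hε1 : ε ≤ 1 / 2 := by rw [hε]; linarith
  have hdR : (1 : ℝ) ≤ d := by exact_mod_cast hd
  set σ : ℝ := ε / (2 * d) with hσ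
  have hσ0 : 0 < σ := by positivity
  have hσd : 2 * σ * d = ε := by rw [hσ]; field_simp
  have hσ1 : σ ≤ 1 / 2 := by nlinarith
  obtain ⟨s, hs⟩ : ∃ s : ℕ, 1 / ε < s := exists_nat_gt _
  have hs0 : (0 : ℝ) < s := lt_trans (by positivity) hs
  have hs1 : 1 ≤ s := by
    have : 0 < s := by exact_mod_cast hs0
    omega
  have hpow : p ≤ (1 - 1 / (s : ℝ) ^ d) * (1 - 2 * σ) ^ d := by
    have h1 : 1 - ε ≤ (1 - 2 * σ) ^ d := by
      have := one_add_mul_le_pow (a := -(2 * σ)) (by linarith) d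
      have e : 1 + -(2 * σ) = 1 - 2 * σ := by ring
      rw [e] at this
      refine le_trans (le_of_eq ?_) this
      rw [← hσd]; ring
    have h2 : 1 - ε ≤ 1 - 1 / (s : ℝ) ^ d := by
      have h3 : (s : ℝ) ≤ (s : ℝ) ^ d := le_self_pow₀ (by exact_mod_cast hs1) (by omega)
      have h4 : 1 / (s : ℝ) ^ d ≤ 1 / s := one_div_le_one_div_of_le hs0 h3
      have h5 : 1 / (s : ℝ) ≤ ε := by
        rw [div_le_iff₀ hs0]
        rw [div_lt_iff₀ hε0] at hs
        linarith
      linarith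
    have h3 := mul_le_mul h2 h1 (by linarith) (by linarith)
    refine le_trans ?_ h3
    have : p = 1 - 2 * ε := by rw [hε]; ring
    nlinarith
  obtain ⟨R, hR⟩ : ∃ R : ℕ, 2 * d₁ / σ < R := exists_nat_gt _
  have hR0 : (0 : ℝ) < R := lt_of_le_of_lt (by positivity) hR
  have hR1 : 1 ≤ R := by
    have : 0 < R := by exact_mod_cast hR0
    omega
  have hRσ : (d₁ : ℝ) / R ≤ σ / 2 := by
    rw [div_lt_iff₀ hσ0] at hR
    rw [div_le_iff₀ hR0]
    linarith
  set A : ℕ := ⌈ζ⌉₊ * d₁ + (⌈β⌉₊ + 3) * (d₁ * d) with hAdef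
  set r : ℕ := s ^ d with hr
  have hr1 : 1 ≤ r := Nat.one_le_pow _ _ hs1
  obtain ⟨N₁, hN₁⟩ := eventually_atTop.1 (hα.eventually_gt_atTop ((A : ℝ) * (r : ℝ) ^ 2))
  refine ⟨max N₁ (2 + d + 3 * s * R), ?_⟩
  intro N hN P hP hPc
  have hNN₁ : N₁ ≤ N := (le_max_left _ _).trans hN
  have hN2 : 2 + d + 3 * s * R ≤ N := (le_max_right _ _).trans hN
  have hN2' : 2 ≤ N := by omega
  have hNd : d < N := by omega
  have hNs : 3 * s * R ≤ N := by omega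
  have hNr : (1 : ℝ) < N := by exact_mod_cast (by omega : 1 < N)
  have hlog : 0 < Real.log N := Real.log_pos hNr
  have hαN : (A : ℝ) * (r : ℝ) ^ 2 * Real.log N < α N := by
    have := hN₁ N hNN₁
    rwa [lt_div_iff₀ hlog] at this
  have hα0 : 0 < α N := lt_of_le_of_lt (by positivity) hαN
  set L : ℕ := N ^ (⌈β⌉₊ + 1) with hL
  have hL1 : 1 ≤ L := Nat.one_le_pow _ _ (by omega)
  have hL0 : (0 : ℝ) < L := by exact_mod_cast hL1
  have hρ : (d : ℝ) / L < (N : ℝ) ^ (-β) := by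
    have h1 : (N : ℝ) ^ β ≤ (N : ℝ) ^ ⌈β⌉₊ := by
      rw [← Real.rpow_natCast]
      exact Real.rpow_le_rpow_of_exponent_le hNr.le (Nat.le_ceil _)
    have hNβ : (0 : ℝ) < (N : ℝ) ^ β := Real.rpow_pos_of_pos (by linarith) _
    have h2 : (L : ℝ) = (N : ℝ) ^ ⌈β⌉₊ * N := by rw [hL]; push_cast; ring
    have h3 : (d : ℝ) < N := by exact_mod_cast hNd
    rw [Real.rpow_neg (by linarith), div_lt_iff₀ hL0, inv_mul_eq_div, lt_div_iff₀ hNβ, h2]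
    have : (d : ℝ) * (N : ℝ) ^ β < N * (N : ℝ) ^ β := by gcongr
    nlinarith
  set Z : Finset ((Fin d → ℤ) × (Fin d → Fin s)) :=
    (Fintype.piFinset fun _ : Fin d => Finset.Ico (-((N : ℤ) * L)) (N * L)) ×ˢ
          (Finset.univ : Finset (Fin d → Fin s)) with hZdef
  have hZ : ∀ c, c ∈ Z ↔ ∀ j, -((N : ℤ) * L) ≤ c.1 j ∧ c.1 j < N * L := by
    intro c
    simp [hZdef]
  have hfinH : ∀ D, (hitCells P ((s : ℝ) * L) ((s : ℝ) * L * R) σ Z D).Finite :=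
    fun D => Z.finite_toSet.subset fun c hc => hc.1
  let Ds0 : Finset ((Fin d₁ → EuclideanSpace ℝ (Fin d₁)) × (Fin d₁ → Fin d → ℤ)) :=
    (Fintype.piFinset fun _ => hP.toFinset) ×ˢ
      (Fintype.piFinset fun _ => Fintype.piFinset fun _ =>
        Finset.Icc (-((N : ℤ) * (s * L * R))) (N * (s * L * R)))
  let Ds := Ds0.filter fun D =>
    α N ≤ ((hitCells P ((s : ℝ) * L) ((s : ℝ) * L * R) σ Z D).ncard : ℝ)
  have hDs : Ds.card ≤ N ^ A := by
    refine (Finset.card_filter_le _ _).trans ?_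
    simp only [Ds0, Finset.card_product, Fintype.card_piFinset, Finset.prod_const, Finset.card_univ,
      Fintype.card_fin, Int.card_Icc]
    have h1 : hP.toFinset.card ≤ N ^ ⌈ζ⌉₊ := by
      rw [← Set.ncard_eq_toFinset_card P hP]
      have : (P.ncard : ℝ) ≤ (N : ℝ) ^ ⌈ζ⌉₊ := by
        refine hPc.trans ?_
        rw [← Real.rpow_natCast]
        exact Real.rpow_le_rpow_of_exponent_le hNr.le (Nat.le_ceil _)
      exact_mod_cast this
    have h2 : ((N : ℤ) * (s * L * R) + 1 - -((N : ℤ) * (s * L * R))).toNat ≤ N ^ (⌈β⌉₊ + 3) := by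
      have e : ((N : ℤ) * (s * L * R) + 1 - -((N : ℤ) * (s * L * R))).toNat
          = 2 * (N * (s * L * R)) + 1 := by
        have : ((N : ℤ) * (s * L * R) + 1 - -((N : ℤ) * (s * L * R))) =
          ((2 * (N * (s * L * R)) + 1 : ℕ) : ℤ) := by push_cast; ring
        rw [this, Int.toNat_natCast]
      rw [e]
      have h3 : 1 ≤ N * (s * L * R) := Nat.one_le_iff_ne_zero.2 (by positivity)
      calc 2 * (N * (s * L * R)) + 1 ≤ 3 * (N * (s * L * R)) := by omega
        _ = (3 * s * R) * (N * L) := by ring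
        _ ≤ N * (N * L) := Nat.mul_le_mul_right _ hNs
        _ = _ := by rw [hL]; ring
    calc _ ≤ (N ^ ⌈ζ⌉₊) ^ d₁ * ((N ^ (⌈β⌉₊ + 3)) ^ d) ^ d₁ := by gcongr
      _ = N ^ A := by
        rw [hAdef, ← pow_mul, ← pow_mul, ← pow_mul, ← pow_add]
        congr 1
        ring
  have hcardκ : Fintype.card (Fin d → Fin s) = r := by simp [hr]
  have : Nonempty (Fin d → Fin s) := ⟨fun _ => ⟨0, hs1⟩⟩
  have hr0 : (0 : ℝ) < r := by exact_mod_cast hr1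
  obtain ⟨f, hf⟩ := comb Ds (fun D => (hfinH D).toFinset) ⌈α N / r⌉₊ (by
      intro D hD
      rw [hcardκ, ← Set.ncard_eq_toFinset_card _ (hfinH D)]
      have h1 := (Finset.mem_filter.1 hD).2
      have h2 : (⌈α N / r⌉₊ : ℝ) < α N / r + 1 := Nat.ceil_lt_add_one (by positivity)
      have h3 : (⌈α N / r⌉₊ : ℝ) * r < (α N / r + 1) * r := by gcongr
      rw [add_mul, div_mul_cancel₀ _ hr0.ne'] at h3
      linarith) (by
      rw [hcardκ]
      exact count_bound hN2' hr1 hαN hDs)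
  refine ⟨⋃ c ∈ Z.filter (fun c => f c.1 ≠ c.2), fcube ((s : ℝ) * L) σ c, ?_, ?_, ?_, ?_⟩
  · exact Finset.measurableSet_biUnion _ fun c _ => fcube_meas (by positivity) c
  · intro x hx i
    simp only [Set.mem_iUnion, Finset.mem_filter] at hx
    obtain ⟨c, ⟨hcZ, _⟩, hx⟩ := hx
    exact fcube_box hs1 hL1 ((hZ c).1 hcZ) (fcube_mono hσ0.le _ hx) i
  · intro m hm
    exact (ENNReal.ofReal_le_ofReal hpow).trans (vol_bound hs1 hL1 hσ0 hσ1 f m hm)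
  · rintro T ⟨S, hS, _, hSA, hSp⟩ hE
    refine core hs1 hL1 hR1 hσ0 hRσ hρ hα0 P hP f Z hZ ?_ T S hS hSA hSp hE
    intro D hD1 hD2 hDA
    have hDmem : D ∈ Ds := by
      simp only [Ds, Ds0, Finset.mem_filter, Finset.mem_product, Fintype.mem_piFinset,
        Set.Finite.mem_toFinset, Finset.mem_Icc]
      exact ⟨⟨hD1, hD2⟩, hDA⟩
    obtain ⟨c, hc, h⟩ := hf D hDmem
    exact ⟨c, (hfinH D).mem_toFinset.1 hc, h⟩
end
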